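/- Fix an integer k ≥ 2. There exist a countable set C ⊆ [0, α*) and a function φ_s : [0, α*) → [0, 1] such that for every α ∈ [0, α*) \ C and every ε > 0, one has lim_{n→∞} P_n(α, φ_s(α) − ε) = 0 and lim_{n→∞} P_n(α, φ_s(α) + ε) = 1. In other words, for every such α the number of solutions Z(F(n,α)) satisfies 2^{n(φ_s(α)−ε)} ≤ Z(F(n,α)) < 2^{n(φ_s(α)+ε)} with probability tending to 1. -/

import Mathlib

open Filter
open scoped Classical Topology BigOperators

noncomputable section

/-- A `k`-clause on `n` Boolean variables: a set of `k` literals (variable–sign pairs)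
over `k` distinct variables.  There are `C(n,k) * 2^k` such clauses. -/
def Clause (n k : ℕ) : Type :=
  {L : Finset (Fin n × Bool) // L.card = k ∧ (L.image Prod.fst).card = k}

instance (n k : ℕ) : Fintype (Clause n k) := Subtype.fintype _

/-- A truth assignment satisfies a clause iff some literal of the clause evaluates to true. -/
def sat {n k : ℕ} (x : Fin n → Bool) (c : Clause n k) : Prop :=
  ∃ l ∈ c.1, x l.1 = l.2

/-- The number of satisfying assignments of the formula given by conjoining the clauses in `F`. -/
def Z {n k : ℕ} (F : Finset (Clause n k)) : ℕ :=
  (Finset.univ.filter fun x : Fin n → Bool => ∀ c ∈ F, sat x c).card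

/-- The probability, under the binomial model in which every clause of `C_k(n)` is selected
independently with probability `p = α n / N`, of drawing precisely the formula `F`. -/
def wt (n k : ℕ) (α : ℝ) (F : Finset (Clause n k)) : ℝ :=
  (α * n / (Fintype.card (Clause n k) : ℝ)) ^ F.card *
    (1 - α * n / (Fintype.card (Clause n k) : ℝ)) ^ (Fintype.card (Clause n k) - F.card)

/-- `P_n(α, φ) = ℙ{Z(F(n,α)) < 2^{nφ}}`. -/
def Pn (k n : ℕ) (α φ : ℝ) : ℝ :=
  ∑ F : Finset (Clause n k),
    if (Z F : ℝ) < (2 : ℝ) ^ ((n : ℝ) * φ) then wt n k α F else 0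

/-- `α* = sup{α : P_n(α,0) = O(1/(log n)^{1+ε}) for some ε > 0}`. -/
def alphaStar (k : ℕ) : ℝ :=
  sSup {α : ℝ | ∃ ε : ℝ, 0 < ε ∧ ∃ C : ℝ,
    ∀ᶠ (n : ℕ) in atTop, Pn k n α 0 ≤ C / Real.log n ^ (1 + ε)}

section ProductLaw

variable {ι κ : Type*} [Fintype ι] [Fintype κ]

/-- The weight of `F` when every `c` is selected independently with probability
`1 - exp (-lam c)`. -/
def wgt (lam : ι → ℝ) (F : Finset ι) : ℝ :=
  ∏ c, if c ∈ F then 1 - Real.exp (-lam c) else Real.exp (-lam c)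

/-- The expectation of `h` under the product law with intensities `lam`. -/
def avg (lam : ι → ℝ) (h : Finset ι → ℝ) : ℝ := ∑ F, wgt lam F * h F

lemma wgt_nonneg {lam : ι → ℝ} (hl : ∀ c, 0 ≤ lam c) (F : Finset ι) : 0 ≤ wgt lam F := by
  refine Finset.prod_nonneg fun c _ => ?_
  split_ifs
  · have : Real.exp (-lam c) ≤ 1 := Real.exp_le_one_iff.2 (by linarith [hl c])
    linarith
  · positivity

lemma sum_wgt (lam : ι → ℝ) : ∑ F, wgt lam F = 1 := by
  have := Finset.prod_add (fun c => 1 - Real.exp (-lam c)) (fun c => Real.exp (-lam c)) Finset.univ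
  simp only [sub_add_cancel, Finset.prod_const_one, Finset.powerset_univ] at this
  rw [this]
  refine Finset.sum_congr rfl fun F _ => ?_
  rw [wgt, Finset.prod_ite]
  congr 2 <;> ext <;> simp

lemma avg_const (lam : ι → ℝ) (a : ℝ) : avg lam (fun _ => a) = a := by
  simp [avg, ← Finset.sum_mul, sum_wgt]

lemma avg_add (lam : ι → ℝ) (g h : Finset ι → ℝ) :
    avg lam (fun F => g F + h F) = avg lam g + avg lam h := by
  simp [avg, mul_add, Finset.sum_add_distrib]

lemma avg_sub (lam : ι → ℝ) (g h : Finset ι → ℝ) :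
    avg lam (fun F => g F - h F) = avg lam g - avg lam h := by
  simp [avg, mul_sub, Finset.sum_sub_distrib]

lemma avg_const_mul (lam : ι → ℝ) (a : ℝ) (h : Finset ι → ℝ) :
    avg lam (fun F => a * h F) = a * avg lam h := by
  simp only [avg, Finset.mul_sum]
  exact Finset.sum_congr rfl fun F _ => by ring

lemma avg_mono {lam : ι → ℝ} (hl : ∀ c, 0 ≤ lam c) {g h : Finset ι → ℝ} (hgh : ∀ F, g F ≤ h F) :
    avg lam g ≤ avg lam h :=
  Finset.sum_le_sum fun F _ => mul_le_mul_of_nonneg_left (hgh F) (wgt_nonneg hl F)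

/-- Summing over all sets by pairing each set that misses `c` with the set obtained by
inserting `c`. -/
lemma sum_finset_pair (c : ι) (f : Finset ι → ℝ) :
    ∑ F, f F = ∑ F with c ∉ F, (f F + f (insert c F)) := by
  rw [Finset.sum_add_distrib, ← Finset.sum_filter_add_sum_filter_not Finset.univ (fun F => c ∉ F)]
  congr 1
  refine Finset.sum_bij' (fun F _ => F.erase c) (fun F _ => insert c F) ?_ ?_ ?_ ?_ ?_
  · simp
  · simp
  · intro F hF
    simp only [Finset.mem_filter, not_not] at hF
    exact Finset.insert_erase hF.2
  · intro F hF
    simp only [Finset.mem_filter] at hF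
    exact Finset.erase_insert hF.2
  · intro F hF
    simp only [Finset.mem_filter, not_not] at hF
    rw [Finset.insert_erase hF.2]

lemma hasDerivAt_avg (lam mu : ι → ℝ) (h : Finset ι → ℝ) (t : ℝ) :
    HasDerivAt (fun t : ℝ => avg (fun c => t * lam c + (1 - t) * mu c) h)
      (avg (fun c => t * lam c + (1 - t) * mu c)
        fun F => ∑ c, (lam c - mu c) * (h (insert c F) - h F)) t := by
  set nu : ι → ℝ := fun c => t * lam c + (1 - t) * mu c with hnu
  have hfac : ∀ c : ι, HasDerivAt (fun t : ℝ => Real.exp (-(t * lam c + (1 - t) * mu c)))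
      (-(lam c - mu c) * Real.exp (-nu c)) t := by
    intro c
    have h1 : HasDerivAt (fun t : ℝ => -(t * lam c + (1 - t) * mu c)) (-(lam c - mu c)) t := by
      have := (((hasDerivAt_id t).mul_const (lam c)).add
        (((hasDerivAt_id t).const_sub 1).mul_const (mu c))).neg
      convert! this using 1
      simp; ring
    have := h1.exp
    rwa [mul_comm] at this
  have hw : ∀ F : Finset ι, HasDerivAt (fun t : ℝ => wgt (fun c => t * lam c + (1 - t) * mu c) F)
      (∑ c, (∏ d ∈ Finset.univ.erase c,
        if d ∈ F then 1 - Real.exp (-nu d) else Real.exp (-nu d)) *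
        ((if c ∈ F then (1 : ℝ) else -1) * ((lam c - mu c) * Real.exp (-nu c)))) t := by
    intro F
    unfold wgt
    refine HasDerivAt.fun_finsetProd (u := Finset.univ) fun c _ => ?_
    by_cases hc : c ∈ F
    · simp only [hc, if_true]
      convert! (hfac c).const_sub 1 using 1
      ring
    · simp only [hc, if_false]
      convert! hfac c using 1
      ring
  have := HasDerivAt.fun_sum (u := Finset.univ) fun F _ => (hw F).mul_const (h F)
  unfold avg
  convert! this using 1
  simp only [Finset.mul_sum, Finset.sum_mul]
  rw [Finset.sum_comm, Finset.sum_comm (s := Finset.univ (α := Finset ι))]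
  refine Finset.sum_congr rfl fun c _ => ?_
  rw [sum_finset_pair c, sum_finset_pair c]
  refine Finset.sum_congr rfl fun F hF => ?_
  simp only [Finset.mem_filter, Finset.mem_univ, true_and] at hF
  have hprod : ∏ d ∈ Finset.univ.erase c,
        (if d ∈ insert c F then 1 - Real.exp (-nu d) else Real.exp (-nu d)) =
      ∏ d ∈ Finset.univ.erase c, if d ∈ F then 1 - Real.exp (-nu d) else Real.exp (-nu d) := by
    refine Finset.prod_congr rfl fun d hd => ?_
    simp [Finset.ne_of_mem_erase hd]
  have hwF : wgt nu F = Real.exp (-nu c) *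
      ∏ d ∈ Finset.univ.erase c, if d ∈ F then 1 - Real.exp (-nu d) else Real.exp (-nu d) := by
    rw [wgt, ← Finset.mul_prod_erase Finset.univ _ (Finset.mem_univ c)]
    simp [hF]
  rw [hprod, hwF]
  simp [hF]
  ring

/-- A bound on the drift along the segment of intensities bounds the change of the average. -/
lemma avg_le_avg_add {lam mu : ι → ℝ} (hl : ∀ c, 0 ≤ lam c) (hm : ∀ c, 0 ≤ mu c)
    {h : Finset ι → ℝ} {D : ℝ}
    (hD : ∀ F, ∑ c, (lam c - mu c) * (h (insert c F) - h F) ≤ D) :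
    avg lam h ≤ avg mu h + D := by
  set f : ℝ → ℝ := fun t => avg (fun c => t * lam c + (1 - t) * mu c) h
  have hf := hasDerivAt_avg lam mu h
  have hdiff : Differentiable ℝ f := fun t => (hf t).differentiableAt
  have key := (convex_Icc (0 : ℝ) 1).image_sub_le_mul_sub_of_deriv_le
    hdiff.continuous.continuousOn hdiff.differentiableOn (C := D) (by
      intro t ht
      rw [interior_Icc] at ht
      rw [(hf t).deriv]
      have hnn : ∀ c, 0 ≤ t * lam c + (1 - t) * mu c := fun c =>
        add_nonneg (mul_nonneg ht.1.le (hl c)) (mul_nonneg (by linarith [ht.2]) (hm c))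
      calc _ ≤ avg (fun c => t * lam c + (1 - t) * mu c) (fun _ => D) := avg_mono hnn hD
        _ = D := avg_const _ _) 0 (by simp) 1 (by simp) zero_le_one
  simp [f] at key
  linarith

lemma avg_le_of_antitone {lam mu : ι → ℝ} (hm : ∀ c, 0 ≤ mu c) (hle : ∀ c, mu c ≤ lam c)
    {h : Finset ι → ℝ} (hh : Antitone h) : avg lam h ≤ avg mu h := by
  have := avg_le_avg_add (h := h) (D := 0) (fun c => (hm c).trans (hle c)) hm fun F =>
    Finset.sum_nonpos fun c _ => mul_nonpos_of_nonneg_of_nonpos (sub_nonneg.2 (hle c))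
      (sub_nonpos.2 (hh (Finset.subset_insert c F)))
  simpa using this

lemma avg_le_of_monotone {lam mu : ι → ℝ} (hm : ∀ c, 0 ≤ mu c) (hle : ∀ c, mu c ≤ lam c)
    {h : Finset ι → ℝ} (hh : Monotone h) : avg mu h ≤ avg lam h := by
  have := avg_le_of_antitone hm hle (h := fun F => (-1) * h F) fun F G hFG => by
    simpa using hh hFG
  rw [avg_const_mul, avg_const_mul] at this
  linarith

/-- Coordinates of intensity zero can be discarded. -/
lemma avg_eq_avg_map (e : κ ↪ ι) {lam : ι → ℝ} (h0 : ∀ c ∉ Set.range e, lam c = 0)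
    (h : Finset ι → ℝ) : avg lam h = avg (fun d => lam (e d)) fun G => h (G.map e) := by
  unfold avg
  have hinj : Set.InjOn (fun G : Finset κ => G.map e) (Finset.univ : Finset (Finset κ)) :=
    (Finset.map_injective e).injOn
  have hout : ∀ F ∈ (Finset.univ : Finset (Finset ι)),
      F ∉ Finset.univ.image (fun G : Finset κ => G.map e) → wgt lam F * h F = 0 := by
    intro F _ hF
    have : ∃ c ∈ F, c ∉ Set.range e := by
      by_contra! hcon
      apply hF
      simp only [Finset.mem_image, Finset.mem_univ, true_and]
      refine ⟨Finset.univ.filter fun d => e d ∈ F, ?_⟩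
      ext c
      simp only [Finset.mem_map, Finset.mem_filter, Finset.mem_univ, true_and]
      constructor
      · rintro ⟨d, hd, rfl⟩; exact hd
      · intro hc
        obtain ⟨d, rfl⟩ := hcon c hc
        exact ⟨d, hc, rfl⟩
    obtain ⟨c, hc, hr⟩ := this
    have : wgt lam F = 0 := Finset.prod_eq_zero (Finset.mem_univ c) (by simp [hc, h0 c hr])
    rw [this, zero_mul]
  rw [← Finset.sum_subset (Finset.subset_univ _) hout, Finset.sum_image hinj]
  refine Finset.sum_congr rfl fun G _ => ?_
  congr 1
  unfold wgt
  have h1 : ∀ c ∈ (Finset.univ : Finset ι), c ∉ Finset.univ.map e →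
      (if c ∈ G.map e then 1 - Real.exp (-lam c) else Real.exp (-lam c)) = 1 := by
    intro c _ hc
    have hr : c ∉ Set.range e := by simpa using hc
    have : c ∉ G.map e := fun hcG => hc (Finset.map_subset_map.2 (Finset.subset_univ G) hcG)
    rw [if_neg this, h0 c hr]
    simp
  rw [← Finset.prod_subset (Finset.subset_univ _) h1, Finset.prod_map]
  simp

/-- A subset of `κ × ι` seen as a family of subsets of `ι`. -/
def finsetProdEquiv (κ ι : Type*) [Fintype κ] [Fintype ι] :
    (κ → Finset ι) ≃ Finset (κ × ι) where
  toFun G := Finset.univ.filter fun p => p.2 ∈ G p.1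
  invFun F i := Finset.univ.filter fun c => (i, c) ∈ F
  left_inv G := by ext; simp
  right_inv F := by ext; simp

/-- The product law on `κ × ι` is the law of independent copies of the product law on `ι`. -/
lemma avg_prod [DecidableEq κ] (lam : ι → ℝ) (h : Finset (κ × ι) → ℝ) :
    avg (fun p : κ × ι => lam p.2) h =
      ∑ G : κ → Finset ι, (∏ i, wgt lam (G i)) * h (finsetProdEquiv κ ι G) := by
  unfold avg
  rw [← (finsetProdEquiv κ ι).sum_comp]
  refine Finset.sum_congr rfl fun G _ => ?_
  congr 1
  unfold wgt
  rw [Fintype.prod_prod_type]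
  simp [finsetProdEquiv]

/-- The average over independent copies of a product of functions of the copies. -/
lemma sum_prod_wgt_mul_prod [DecidableEq κ] (lam : ι → ℝ) (g : κ → Finset ι → ℝ) :
    ∑ G : κ → Finset ι, (∏ i, wgt lam (G i)) * ∏ i, g i (G i) = ∏ i, avg lam (g i) := by
  unfold avg
  rw [Fintype.prod_sum]
  simp [Finset.prod_mul_distrib]

/-- The average over independent copies of a function of one of the copies. -/
lemma sum_prod_wgt_mul_single [DecidableEq κ] (lam : ι → ℝ) (j : κ) (f : Finset ι → ℝ) :
    ∑ G : κ → Finset ι, (∏ i, wgt lam (G i)) * f (G j) = avg lam f := by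
  have := sum_prod_wgt_mul_prod (κ := κ) lam (fun i F => if i = j then f F else 1)
  simp only [Finset.prod_ite_eq', Finset.mem_univ, if_true] at this
  rw [this, Finset.prod_eq_single j]
  · simp
  · intro b _ hb
    simp [hb, avg_const]
  · simp

end ProductLaw

section Clauses

variable {n k : ℕ}

/-- The variables that occur in a clause. -/
def Clause.vars (c : Clause n k) : Finset (Fin n) := c.1.image Prod.fst

lemma not_sat_iff (x : Fin n → Bool) (c : Clause n k) :
    ¬ sat x c ↔ ∀ l ∈ c.1, l.2 = !x l.1 := by
  simp only [sat, not_exists, not_and]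
  refine forall₂_congr fun l _ => ?_
  cases x l.1 <;> cases l.2 <;> simp

/-- The clause on the variable set `S` whose signs are given by `f`. -/
def mkClause (f : Fin n → Bool) (S : Finset (Fin n)) (hS : S.card = k) : Clause n k :=
  ⟨S.image fun i => (i, f i), by
    rw [Finset.card_image_of_injective _ fun i j h => (Prod.ext_iff.1 h).1, hS], by
    rw [Finset.image_image]
    simpa [Function.comp_def] using hS⟩

lemma mkClause_vars (f : Fin n → Bool) (S : Finset (Fin n)) (hS : S.card = k) :
    (mkClause f S hS).vars = S := by
  simp [mkClause, Clause.vars, Finset.image_image, Function.comp_def]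

lemma Clause.fst_injOn (c : Clause n k) : Set.InjOn Prod.fst (c.1 : Set (Fin n × Bool)) :=
  Finset.card_image_iff.1 (c.2.2.trans c.2.1.symm)

lemma eq_mkClause (c : Clause n k) (f : Fin n → Bool) (h : ∀ l ∈ c.1, l.2 = f l.1) :
    mkClause f c.vars c.2.2 = c := by
  apply Subtype.ext
  ext ⟨i, b⟩
  simp only [mkClause, Clause.vars, Finset.mem_image, Prod.mk.injEq, Prod.exists,
    exists_and_right, exists_eq_right]
  constructor
  · rintro ⟨j, ⟨b', hb'⟩, rfl, rfl⟩
    have := h _ hb'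
    simp only at this
    rwa [← this]
  · intro hc
    exact ⟨i, ⟨b, hc⟩, rfl, (h _ hc).symm⟩

/-- The clauses inside `B` violated by all assignments of a nonempty family correspond to the
`k`-subsets of the variables of `B` on which the family agrees. -/
lemma card_violated {σ : Type*} (x : σ → Fin n → Bool) (a₀ : σ) (B : Finset (Fin n)) :
    (Finset.univ.filter fun c : Clause n k => (∀ a, ¬ sat (x a) c) ∧ c.vars ⊆ B).card =
      (B.filter fun i => ∀ a, x a i = x a₀ i).card.choose k := by
  rw [← Finset.card_powersetCard]
  refine Finset.card_bij' (fun c _ => c.vars)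
    (fun S hS => mkClause (fun i => !x a₀ i) S (Finset.mem_powersetCard.1 hS).2) ?_ ?_ ?_ ?_
  · intro c hc
    simp only [Finset.mem_filter, Finset.mem_univ, true_and, not_sat_iff] at hc
    refine Finset.mem_powersetCard.2 ⟨fun i hi => ?_, c.2.2⟩
    refine Finset.mem_filter.2 ⟨hc.2 hi, fun a => ?_⟩
    obtain ⟨l, hl, rfl⟩ := Finset.mem_image.1 hi
    have := (hc.1 a l hl).symm.trans (hc.1 a₀ l hl)
    simpa using this
  · intro S hS
    have hS' := Finset.mem_powersetCard.1 hS
    simp only [Finset.mem_filter, Finset.mem_univ, true_and, not_sat_iff, mkClause_vars]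
    refine ⟨fun a l hl => ?_, fun i hi => (Finset.mem_filter.1 (hS'.1 hi)).1⟩
    obtain ⟨i, hi, rfl⟩ := Finset.mem_image.1 hl
    simp [(Finset.mem_filter.1 (hS'.1 hi)).2 a]
  · intro c hc
    simp only [Finset.mem_filter, Finset.mem_univ, true_and, not_sat_iff] at hc
    exact eq_mkClause c _ (hc.1 a₀)
  · intro S hS
    exact mkClause_vars _ _ _

lemma card_clause (n k : ℕ) : Fintype.card (Clause n k) = n.choose k * 2 ^ k := by
  have h : Fintype.card (Clause n k) = ((Finset.powersetCard k (Finset.univ : Finset (Fin n))).sigma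
      fun S => Fintype.piFinset fun i => if i ∈ S then Finset.univ else {false}).card := by
    rw [← Finset.card_univ]
    symm
    refine Finset.card_bij
      (fun p hp => mkClause p.2 p.1 (Finset.mem_powersetCard.1 (Finset.mem_sigma.1 hp).1).2)
      (fun _ _ => Finset.mem_univ _) ?_ ?_
    · rintro ⟨S, f⟩ hp ⟨T, g⟩ hq heq
      have hST : S = T := by
        have := congrArg Clause.vars heq
        simpa only [mkClause_vars] using this
      subst hST
      congr 1
      funext i
      simp only [Finset.mem_sigma, Fintype.mem_piFinset] at hp hq
      by_cases hi : i ∈ S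
      · have hmem : (i, f i) ∈ (mkClause g S (Finset.mem_powersetCard.1 hp.1).2).1 := by
          rw [← heq]
          exact Finset.mem_image_of_mem _ hi
        obtain ⟨j, _, hj⟩ := Finset.mem_image.1 hmem
        simp only [Prod.mk.injEq] at hj
        obtain ⟨rfl, hj⟩ := hj
        exact hj.symm
      · have h1 := hp.2 i
        have h2 := hq.2 i
        simp only [hi, if_false, Finset.mem_singleton] at h1 h2
        rw [h1, h2]
    · intro c _
      have hf : ∀ l ∈ c.1, l.2 = (fun i => decide ((i, true) ∈ c.1)) l.1 := by
        rintro ⟨i, b⟩ hl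
        cases b
        · simp only [Bool.false_eq, decide_eq_false_iff_not]
          intro ht
          have := c.fst_injOn hl ht rfl
          simp at this
        · simpa using hl
      refine ⟨⟨c.vars, fun i => decide ((i, true) ∈ c.1)⟩, ?_, eq_mkClause c _ hf⟩
      simp only [Finset.mem_sigma, Finset.mem_powersetCard, Finset.subset_univ, true_and,
        Fintype.mem_piFinset]
      refine ⟨c.2.2, fun i => ?_⟩
      by_cases hi : i ∈ c.vars
      · rw [if_pos hi]
        exact Finset.mem_univ _
      · simp only [hi, if_false, Finset.mem_singleton, decide_eq_false_iff_not]
        exact fun ht => hi (Finset.mem_image_of_mem Prod.fst ht)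
  rw [h, Finset.card_sigma, Finset.sum_congr rfl (g := fun _ => 2 ^ k), Finset.sum_const,
    Finset.card_powersetCard]
  · simp
  · intro S hS
    rw [Fintype.card_piFinset]
    simp only [apply_ite Finset.card, Finset.card_univ, Fintype.card_bool, Finset.card_singleton]
    rw [Finset.prod_ite_mem, Finset.univ_inter, Finset.prod_const,
      (Finset.mem_powersetCard.1 hS).2]

/-- Renaming the variables of a clause. -/
def clauseMap {n' : ℕ} (e : Fin n ↪ Fin n') : Clause n k ↪ Clause n' k where
  toFun c := ⟨c.1.map (e.prodMap (Function.Embedding.refl Bool)), by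
    simp [c.2.1], by
    have : (c.1.map (e.prodMap (Function.Embedding.refl Bool))).image Prod.fst
        = (c.1.image Prod.fst).map e := by
      simp [Finset.map_eq_image, Finset.image_image, Function.comp_def]
    rw [this, Finset.card_map, c.2.2]⟩
  inj' c d h := Subtype.ext (Finset.map_injective _ (Subtype.ext_iff.1 h))

lemma clauseMap_val {n' : ℕ} (e : Fin n ↪ Fin n') (c : Clause n k) :
    (clauseMap e c).1 = c.1.map (e.prodMap (Function.Embedding.refl Bool)) := rfl

lemma clauseMap_vars {n' : ℕ} (e : Fin n ↪ Fin n') (c : Clause n k) :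
    (clauseMap e c).vars = c.vars.map e := by
  simp [Clause.vars, clauseMap_val, Finset.map_eq_image, Finset.image_image, Function.comp_def]

lemma sat_clauseMap {n' : ℕ} (e : Fin n ↪ Fin n') (c : Clause n k) (x : Fin n' → Bool) :
    sat x (clauseMap e c) ↔ sat (x ∘ e) c := by
  constructor
  · rintro ⟨l, hl, hx⟩
    obtain ⟨l', hl', rfl⟩ := Finset.mem_map.1 hl
    exact ⟨l', hl', hx⟩
  · rintro ⟨l, hl, hx⟩
    exact ⟨(e l.1, l.2), Finset.mem_map_of_mem _ hl, hx⟩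

lemma mem_range_clauseMap {n' : ℕ} (e : Fin n ↪ Fin n') (c : Clause n' k)
    (h : c.vars ⊆ Finset.univ.map e) : c ∈ Set.range (clauseMap (k := k) e) := by
  have hr : ∀ l ∈ c.1, ∃ i, e i = l.1 := fun l hl => by
    simpa using h (Finset.mem_image_of_mem Prod.fst hl)
  have hmap : (Finset.univ.filter fun l : Fin n × Bool => (e l.1, l.2) ∈ c.1).map
      (e.prodMap (Function.Embedding.refl Bool)) = c.1 := by
    ext ⟨i, b⟩
    simp only [Finset.mem_map, Finset.mem_filter, Finset.mem_univ, true_and,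
      Function.Embedding.coe_prodMap, Prod.exists, Prod.map_apply, Function.Embedding.refl_apply,
      Prod.mk.injEq]
    constructor
    · rintro ⟨j, b', hj, rfl, rfl⟩; exact hj
    · intro hc
      obtain ⟨j, hj⟩ := hr _ hc
      simp only at hj
      subst hj
      exact ⟨j, b, hc, rfl, rfl⟩
  refine ⟨⟨Finset.univ.filter fun l : Fin n × Bool => (e l.1, l.2) ∈ c.1, ?_, ?_⟩, ?_⟩
  · rw [← Finset.card_map (e.prodMap (Function.Embedding.refl Bool)), hmap, c.2.1]
  · rw [← Finset.card_map e]
    refine Eq.trans ?_ c.2.2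
    congr 1
    conv_rhs => rw [← hmap]
    simp [Finset.map_eq_image, Finset.image_image, Function.comp_def]
  · exact Subtype.ext hmap

lemma Z_antitone : Antitone (Z : Finset (Clause n k) → ℕ) := fun F G hFG =>
  Finset.card_le_card fun x hx => by
    simp only [Finset.mem_filter, Finset.mem_univ, true_and] at hx ⊢
    exact fun c hc => hx c (hFG hc)

lemma Z_le (F : Finset (Clause n k)) : Z F ≤ 2 ^ n := by
  refine (Finset.card_le_univ _).trans ?_
  simp

/-- The `i`-th block of variables when `m * n` variables are cut into `m` blocks. -/
def blockEmb (m n : ℕ) (i : Fin m) : Fin n ↪ Fin (m * n) :=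
  ⟨fun v => finProdFinEquiv (i, v), fun v w h => by simpa using h⟩

/-- The clauses all of whose variables lie in one block. -/
def blockClause (m n : ℕ) (hk : 1 ≤ k) : Fin m × Clause n k ↪ Clause (m * n) k where
  toFun p := clauseMap (blockEmb m n p.1) p.2
  inj' := by
    rintro ⟨i, c⟩ ⟨j, d⟩ h
    simp only at h
    have hij : i = j := by
      have hne : c.vars.Nonempty := Finset.card_pos.1 (by rw [Clause.vars, c.2.2]; exact hk)
      obtain ⟨v, hv⟩ := hne
      have : blockEmb m n i v ∈ (clauseMap (blockEmb m n j) d).vars := by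
        rw [← h, clauseMap_vars]
        exact Finset.mem_map_of_mem _ hv
      rw [clauseMap_vars] at this
      obtain ⟨w, _, hw⟩ := Finset.mem_map.1 this
      have := finProdFinEquiv.injective hw
      simp only [Prod.mk.injEq] at this
      exact this.1.symm
    subst hij
    rw [(clauseMap (blockEmb m n i)).injective h]

lemma Z_blocks (m : ℕ) (hk : 1 ≤ k) (G : Fin m → Finset (Clause n k)) :
    Z ((finsetProdEquiv (Fin m) (Clause n k) G).map (blockClause m n hk)) = ∏ i, Z (G i) := by
  unfold Z
  rw [← Fintype.card_piFinset]
  refine Finset.card_bij' (fun x _ i v => x (finProdFinEquiv (i, v)))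
    (fun y _ u => y (finProdFinEquiv.symm u).1 (finProdFinEquiv.symm u).2) ?_ ?_ ?_ ?_
  · intro x hx
    simp only [Finset.mem_filter, Finset.mem_univ, true_and, Fintype.mem_piFinset] at hx ⊢
    intro i c hc
    have := hx (blockClause m n hk (i, c))
      (Finset.mem_map_of_mem _ (by simpa [finsetProdEquiv] using hc))
    exact (sat_clauseMap _ _ _).1 this
  · intro y hy
    simp only [Finset.mem_filter, Finset.mem_univ, true_and, Fintype.mem_piFinset] at hy ⊢
    intro c hc
    obtain ⟨⟨i, d⟩, hd, rfl⟩ := Finset.mem_map.1 hc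
    refine (sat_clauseMap _ _ _).2 ?_
    have := hy i d (by simpa [finsetProdEquiv] using hd)
    convert! this using 1
    funext v
    change y (finProdFinEquiv.symm (finProdFinEquiv (i, v))).1
      (finProdFinEquiv.symm (finProdFinEquiv (i, v))).2 = y i v
    rw [Equiv.symm_apply_apply]
  · intro x _
    funext u
    simp only [Prod.mk.eta, Equiv.apply_symm_apply]
  · intro y _
    funext i v
    simp

/-- Adding `s` unconstrained variables multiplies the number of solutions by at most `2 ^ s`. -/
lemma Z_castAdd_le (s : ℕ) (G : Finset (Clause n k)) :
    Z (G.map (clauseMap (Fin.castAddEmb s))) ≤ Z G * 2 ^ s := by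
  have hcard : (2 : ℕ) ^ s = (Finset.univ : Finset (Fin s → Bool)).card := by simp
  rw [hcard]
  unfold Z
  rw [← Finset.card_product]
  refine Finset.card_le_card_of_injOn
    (fun x => (fun i => x (Fin.castAdd s i), fun j => x (Fin.natAdd n j))) ?_ ?_
  · intro x hx
    simp only [Finset.coe_filter, Finset.mem_univ, true_and, Set.mem_ofPred_eq] at hx
    simp only [Finset.coe_product, Set.mem_prod, Finset.mem_coe, Finset.mem_filter,
      Finset.mem_univ, true_and, and_true]
    intro c hc
    exact (sat_clauseMap _ _ _).1 (hx _ (Finset.mem_map_of_mem _ hc))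
  · intro x _ y _ hxy
    simp only [Prod.mk.injEq] at hxy
    funext i
    refine Fin.addCases (fun j => congrFun hxy.1 j) (fun j => congrFun hxy.2 j) i

end Clauses

section Drift

/-- The negative powers `(1 - v) ^ (-r)` have nonnegative Taylor coefficients. -/
lemma exists_hasSum_rpow_neg {r : ℝ} (hr : 0 ≤ r) : ∃ b : ℕ → ℝ, (∀ l, 0 ≤ b l) ∧
    ∀ v : ℝ, 0 ≤ v → v < 1 → HasSum (fun l => b l * v ^ (l + 1)) ((1 - v) ^ (-r) - 1) := by
  refine ⟨fun l => Ring.choose (r + (l + 1 : ℕ) - 1) (l + 1), fun l => ?_, fun v hv0 hv1 => ?_⟩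
  · have h1 : Ring.choose (r + (l + 1 : ℕ) - 1) (l + 1) = Ring.multichoose r (l + 1) := by
      rw [Ring.choose]
      congr 1
      ring
    have h2 := Ring.factorial_nsmul_multichoose_eq_ascPochhammer r (l + 1)
    rw [Polynomial.ascPochhammer_smeval_eq_eval, nsmul_eq_mul] at h2
    have h3 : 0 ≤ (ascPochhammer ℝ (l + 1)).eval r := by
      rcases hr.eq_or_lt with h | h
      · rw [← h, ascPochhammer_ne_zero_eval_zero ℝ (Nat.succ_ne_zero l)]
      · exact (ascPochhammer_pos _ _ h).le
    beta_reduce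
    rw [h1]
    have h4 : (0 : ℝ) < ((l + 1).factorial : ℝ) := by positivity
    rw [← h2] at h3
    exact nonneg_of_mul_nonneg_right h3 h4
  · have h := (Real.one_div_one_sub_rpow_hasFPowerSeriesOnBall_zero r).hasSum (y := v) (by
      simp only [Metric.eball, edist_dist, dist_zero_right]
      simpa [abs_of_nonneg hv0] using hv1)
    rw [← hasSum_nat_add_iff' 1] at h
    convert! h using 1
    · funext l
      rw [FormalMultilinearSeries.ofScalars_apply_eq]
      simp
    · rw [Real.rpow_neg (by linarith)]
      simp

lemma card_clause_le (n k : ℕ) : Fintype.card (Clause n k) ≤ 4 ^ n := by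
  rw [card_clause]
  rcases le_or_gt k n with h | h
  · calc n.choose k * 2 ^ k ≤ 2 ^ n * 2 ^ n :=
        Nat.mul_le_mul (Nat.choose_le_two_pow n k) (Nat.pow_le_pow_right (by norm_num) h)
      _ = 4 ^ n := by rw [← mul_pow]; norm_num
  · simp [Nat.choose_eq_zero_of_lt h]

/-- `Z F + 1` as a real number. -/
def W {n k : ℕ} (F : Finset (Clause n k)) : ℝ := Z F + 1

variable {n k : ℕ}

lemma one_le_W (F : Finset (Clause n k)) : 1 ≤ W F := by simp [W]

lemma W_pos (F : Finset (Clause n k)) : 0 < W F := by linarith [one_le_W F]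

lemma W_le (F : Finset (Clause n k)) : W F ≤ 2 ^ (n + 1) := by
  have h1 : (Z F : ℝ) ≤ 2 ^ n := by exact_mod_cast Z_le F
  have h2 : (1 : ℝ) ≤ 2 ^ n := one_le_pow₀ (by norm_num)
  rw [W, pow_succ]
  linarith

/-- The solutions of `F` that violate `c`. -/
def violators (F : Finset (Clause n k)) (c : Clause n k) : Finset (Fin n → Bool) :=
  (Finset.univ.filter fun x : Fin n → Bool => ∀ c ∈ F, sat x c).filter fun x => ¬ sat x c

lemma Z_insert_add (F : Finset (Clause n k)) (c : Clause n k) :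
    Z (insert c F) + (violators F c).card = Z F := by
  unfold Z violators
  rw [← Finset.card_filter_add_card_filter_not (s := Finset.univ.filter fun x : Fin n → Bool =>
    ∀ c ∈ F, sat x c) (fun x => sat x c)]
  congr 2
  ext x
  simp [and_comm]

lemma W_insert (F : Finset (Clause n k)) (c : Clause n k) :
    W (insert c F) = W F - (violators F c).card := by
  have := Z_insert_add F c
  rw [W, W, ← this]
  push_cast
  ring

lemma violators_pow (F : Finset (Clause n k)) (c : Clause n k) (l : ℕ) :
    ((violators F c).card : ℝ) ^ l =
      ∑ x ∈ Fintype.piFinset fun _ : Fin l =>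
          Finset.univ.filter fun x : Fin n → Bool => ∀ c ∈ F, sat x c,
        if ∀ a, ¬ sat (x a) c then (1 : ℝ) else 0 := by
  rw [Finset.sum_boole]
  have : (Fintype.piFinset fun _ : Fin l => Finset.univ.filter fun x : Fin n → Bool =>
      ∀ c ∈ F, sat x c).filter (fun x => ∀ a, ¬ sat (x a) c) =
      Fintype.piFinset fun _ : Fin l => violators F c := by
    ext x
    simp only [violators, Finset.mem_filter, Fintype.mem_piFinset]
    exact ⟨fun h a => ⟨h.1 a, h.2 a⟩, fun h => ⟨fun a => (h a).1, fun a => (h a).2⟩⟩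
  rw [this, Fintype.card_piFinset]
  simp

lemma le_two_mul_pow {y K w : ℝ} {m l : ℕ} (hm : 1 ≤ m) (hK : K ≤ m) (hw : 1 ≤ w)
    (h1 : y ≤ 1) (h2 : y ≤ K * (1 - 1 / w) ^ l) : y ≤ 2 * (1 - 1 / (m * w)) ^ l := by
  have hm' : (1 : ℝ) ≤ m := by exact_mod_cast hm
  have hmw : 1 ≤ m * w := one_le_mul_of_one_le_of_one_le hm' hw
  have hinv : 1 / (m * w) ≤ 1 := by
    rw [div_le_one (by linarith)]; exact hmw
  set t : ℝ := 1 - 1 / (m * w) with ht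
  have ht0 : 0 ≤ t := by linarith
  rcases le_or_gt 1 (2 * t ^ l) with h | h
  · linarith
  · have hw1 : 0 ≤ 1 - 1 / w := by
      have : 1 / w ≤ 1 := by rw [div_le_one (by linarith)]; exact hw
      linarith
    have hbern : 1 - 1 / w ≤ t ^ m := by
      have := one_add_mul_le_pow (a := -(1 / (m * w))) (by linarith) m
      calc 1 - 1 / w = 1 + m * -(1 / (m * w)) := by field_simp; ring
        _ ≤ _ := this
        _ = t ^ m := by rw [ht]; ring
    have hm2 : (m : ℝ) ≤ 2 ^ m := by exact_mod_cast Nat.lt_two_pow_self.le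
    calc y ≤ K * (1 - 1 / w) ^ l := h2
      _ ≤ 2 ^ m * (t ^ m) ^ l := by
        refine mul_le_mul (hK.trans hm2) (pow_le_pow_left₀ hw1 hbern l) (by positivity)
          (by positivity)
      _ = (2 * t ^ l) ^ m := by rw [mul_pow, ← pow_mul, ← pow_mul, mul_comm m l]
      _ ≤ 2 * t ^ l := by
        refine pow_le_of_le_one (by positivity) h.le (by omega)

/-- If for every finite family of assignments the clauses violated by the whole family have at
most `κ` more mass under `lam` than under `mu`, then moving from `mu` to `lam` hardly
increases the mean of `W ^ (-r)`. -/
lemma drift_le {lam mu : Clause n k → ℝ} {κ r : ℝ} (hr : 0 ≤ r) (hκ : 0 ≤ κ)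
    (H : ∀ (l : ℕ) (x : Fin (l + 1) → Fin n → Bool),
      ∑ c, (lam c - mu c) * (if ∀ a, ¬ sat (x a) c then 1 else 0) ≤
        κ * if ∃ c : Clause n k, ∀ a, ¬ sat (x a) c then 1 else 0)
    (F : Finset (Clause n k)) :
    ∑ c, (lam c - mu c) * (W (insert c F) ^ (-r) - W F ^ (-r)) ≤
      2 * κ * ((4 ^ n * 2 ^ (n + 1)) ^ r - 1) := by
  obtain ⟨b, hb0, hb⟩ := exists_hasSum_rpow_neg hr
  set w := W F with hw
  have hw1 : 1 ≤ w := one_le_W F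
  have hwpos : 0 < w := W_pos F
  set V : Clause n k → ℝ := fun c => (violators F c).card with hV
  have hVZ : ∀ c, V c ≤ w - 1 := fun c => by
    have : (violators F c).card ≤ Z F := by have := Z_insert_add F c; omega
    have : ((violators F c).card : ℝ) ≤ Z F := by exact_mod_cast this
    simpa [hw, W, hV] using this
  have hV0 : ∀ c, 0 ≤ V c := fun c => by positivity
  have hv1 : ∀ c, V c / w < 1 := fun c => by
    rw [div_lt_one hwpos]; linarith [hVZ c]
  have hstep : ∀ c, W (insert c F) ^ (-r) - w ^ (-r) =
      w ^ (-r) * ((1 - V c / w) ^ (-r) - 1) := fun c => by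
    have : W (insert c F) = w * (1 - V c / w) := by
      rw [W_insert]; field_simp; rfl
    rw [this, Real.mul_rpow hwpos.le (by linarith [hv1 c])]
    ring
  set t : ℝ := 1 - 1 / ((4 ^ n : ℕ) * w) with ht
  have hmw : 1 ≤ ((4 ^ n : ℕ) : ℝ) * w :=
    one_le_mul_of_one_le_of_one_le (by exact_mod_cast Nat.one_le_pow _ _ (by norm_num)) hw1
  have ht0 : 0 ≤ t := by
    have : 1 / (((4 ^ n : ℕ) : ℝ) * w) ≤ 1 := by
      rw [div_le_one (by linarith)]; exact hmw
    linarith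
  have ht1 : t < 1 := by
    have : 0 < 1 / (((4 ^ n : ℕ) : ℝ) * w) := by positivity
    linarith
  have hcoef : ∀ l : ℕ, ∑ c, (lam c - mu c) * (V c / w) ^ (l + 1) ≤ 2 * κ * t ^ (l + 1) := by
    intro l
    set P := Fintype.piFinset fun _ : Fin (l + 1) =>
          Finset.univ.filter fun x : Fin n → Bool => ∀ c ∈ F, sat x c with hP
    set A : ℝ := ∑ x ∈ P, if ∃ c : Clause n k, ∀ a, ¬ sat (x a) c then (1 : ℝ) else 0 with hA
    have h1 : ∑ c, (lam c - mu c) * V c ^ (l + 1) ≤ κ * A := by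
      calc ∑ c, (lam c - mu c) * V c ^ (l + 1)
          = ∑ x ∈ P, ∑ c, (lam c - mu c) * (if ∀ a, ¬ sat (x a) c then 1 else 0) := by
            rw [Finset.sum_comm]
            refine Finset.sum_congr rfl fun c _ => ?_
            rw [hV]
            simp only
            rw [violators_pow, Finset.mul_sum]
        _ ≤ _ := by
            rw [hA, Finset.mul_sum]
            exact Finset.sum_le_sum fun x _ => H l x
    have hA1 : A ≤ (w - 1) ^ (l + 1) := by
      calc A ≤ ∑ x ∈ P, (1 : ℝ) := Finset.sum_le_sum fun x _ => by split_ifs <;> norm_num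
        _ = (w - 1) ^ (l + 1) := by
          simp [hP, Fintype.card_piFinset, hw, W, Z]
    have hA2 : A ≤ Fintype.card (Clause n k) * (w - 1) ^ (l + 1) := by
      calc A ≤ ∑ x ∈ P, ∑ c : Clause n k, if ∀ a, ¬ sat (x a) c then (1 : ℝ) else 0 := by
            refine Finset.sum_le_sum fun x _ => ?_
            split_ifs with h
            · obtain ⟨c, hc⟩ := h
              refine le_trans (by rw [if_pos hc]) (Finset.single_le_sum (f := fun c : Clause n k =>
                if ∀ a, ¬ sat (x a) c then (1 : ℝ) else 0) (fun d _ => ?_) (Finset.mem_univ c))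
              split_ifs <;> norm_num
            · exact Finset.sum_nonneg fun d _ => by split_ifs <;> norm_num
        _ = ∑ c : Clause n k, V c ^ (l + 1) := by
            rw [Finset.sum_comm]
            exact Finset.sum_congr rfl fun c _ => (violators_pow F c (l + 1)).symm
        _ ≤ ∑ c : Clause n k, (w - 1) ^ (l + 1) :=
            Finset.sum_le_sum fun c _ => pow_le_pow_left₀ (hV0 c) (hVZ c) _
        _ = _ := by simp
    have hwl : 0 < w ^ (l + 1) := by positivity
    have h2 : A / w ^ (l + 1) ≤ 2 * t ^ (l + 1) := by
      refine le_two_mul_pow (K := Fintype.card (Clause n k)) (w := w)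
        (Nat.one_le_pow _ _ (by norm_num)) (by exact_mod_cast card_clause_le n k) hw1 ?_ ?_
      · rw [div_le_one hwl]
        exact hA1.trans (pow_le_pow_left₀ (by linarith) (by linarith) _)
      · rw [div_le_iff₀ hwl, mul_assoc, ← mul_pow]
        convert! hA2 using 3
        field_simp
    calc ∑ c, (lam c - mu c) * (V c / w) ^ (l + 1)
        = (∑ c, (lam c - mu c) * V c ^ (l + 1)) / w ^ (l + 1) := by
          rw [Finset.sum_div]
          exact Finset.sum_congr rfl fun c _ => by rw [div_pow]; ring
      _ ≤ κ * A / w ^ (l + 1) := by gcongr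
      _ = κ * (A / w ^ (l + 1)) := by ring
      _ ≤ κ * (2 * t ^ (l + 1)) := by gcongr
      _ = _ := by ring
  have hL : HasSum (fun l => b l * ∑ c, (lam c - mu c) * (V c / w) ^ (l + 1))
      (∑ c, (lam c - mu c) * ((1 - V c / w) ^ (-r) - 1)) := by
    have := hasSum_sum (s := Finset.univ) fun (c : Clause n k) _ =>
      (hb (V c / w) (div_nonneg (hV0 c) hwpos.le) (hv1 c)).mul_left (lam c - mu c)
    convert! this using 1
    funext l
    rw [Finset.mul_sum]
    exact Finset.sum_congr rfl fun c _ => by ring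
  have hR := (hb t ht0 ht1).mul_left (2 * κ)
  have hsum : ∑ c, (lam c - mu c) * ((1 - V c / w) ^ (-r) - 1) ≤
      2 * κ * ((1 - t) ^ (-r) - 1) := hasSum_le (fun l => by
    calc _ ≤ b l * (2 * κ * t ^ (l + 1)) := mul_le_mul_of_nonneg_left (hcoef l) (hb0 l)
      _ = _ := by ring) hL hR
  have hG : (1 - t) ^ (-r) = (((4 ^ n : ℕ) : ℝ) * w) ^ r := by
    rw [ht, sub_sub_cancel, one_div, Real.inv_rpow (by positivity), Real.rpow_neg (by positivity),
      inv_inv]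
  have hG1 : (1 - t) ^ (-r) ≤ (4 ^ n * 2 ^ (n + 1)) ^ r := by
    rw [hG]
    refine Real.rpow_le_rpow (by positivity) ?_ hr
    push_cast
    exact mul_le_mul_of_nonneg_left (W_le F) (by positivity)
  have hone : 1 ≤ (1 - t) ^ (-r) := by
    rw [hG]
    exact Real.one_le_rpow hmw hr
  have hwr : w ^ (-r) ≤ 1 := Real.rpow_le_one_of_one_le_of_nonpos hw1 (by linarith)
  have hwr0 : 0 ≤ w ^ (-r) := by positivity
  calc ∑ c, (lam c - mu c) * (W (insert c F) ^ (-r) - w ^ (-r))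
      = w ^ (-r) * ∑ c, (lam c - mu c) * ((1 - V c / w) ^ (-r) - 1) := by
        rw [Finset.mul_sum]
        exact Finset.sum_congr rfl fun c _ => by rw [hstep]; ring
    _ ≤ w ^ (-r) * (2 * κ * ((1 - t) ^ (-r) - 1)) := mul_le_mul_of_nonneg_left hsum hwr0
    _ ≤ 1 * (2 * κ * ((1 - t) ^ (-r) - 1)) := by
        refine mul_le_mul_of_nonneg_right hwr ?_
        have : 0 ≤ (1 - t) ^ (-r) - 1 := by linarith
        positivity
    _ ≤ _ := by
        rw [one_mul]
        gcongr

end Drift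

section Merge

lemma choose_sum_le {m k : ℕ} (hk : 1 ≤ k) {δ : ℝ} (hδ0 : 0 < δ) (hδ1 : δ ≤ 1)
    (M : Fin m → ℕ) :
    (1 - δ) * ((∑ i, M i).choose k : ℝ) ≤
      (m : ℝ) ^ (k - 1) * ∑ i, ((M i).choose k : ℝ) + (m * k ^ 2 / δ) ^ k := by
  set T := ∑ i, M i with hT
  have hS : 0 ≤ (m : ℝ) ^ (k - 1) * ∑ i, ((M i).choose k : ℝ) := by positivity
  have hK : 0 ≤ (m * k ^ 2 / δ : ℝ) ^ k := by positivity
  rcases lt_or_ge (T : ℝ) (m * k ^ 2 / δ) with h | h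
  · have h1 : ((T.choose k : ℕ) : ℝ) ≤ (m * k ^ 2 / δ) ^ k := by
      calc ((T.choose k : ℕ) : ℝ) ≤ (T : ℝ) ^ k := by exact_mod_cast Nat.choose_le_pow T k
        _ ≤ _ := pow_le_pow_left₀ (by positivity) h.le k
    have h2 : (0 : ℝ) ≤ (T.choose k : ℕ) := by positivity
    nlinarith
  · rcases Nat.eq_zero_or_pos T with hT0 | hTpos
    · rw [hT0, Nat.choose_eq_zero_of_lt (by omega)]
      simp only [Nat.cast_zero, mul_zero]
      linarith
    have hTr : (0 : ℝ) < T := by exact_mod_cast hTpos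
    rcases Nat.eq_zero_or_pos m with hm0 | hmpos
    · subst hm0
      simp at hT
      omega
    have hmr : (0 : ℝ) < m := by exact_mod_cast hmpos
    have hkr : (1 : ℝ) ≤ k := by exact_mod_cast hk
    have hfac : (0 : ℝ) < (k.factorial : ℝ) := by positivity
    have hdesc : ∀ N : ℕ, (k.factorial : ℝ) * (N.choose k : ℝ) = (N.descFactorial k : ℝ) :=
      fun N => by rw [Nat.descFactorial_eq_factorial_mul_choose]; push_cast; ring
    have h1 : (k.factorial : ℝ) * (T.choose k : ℝ) ≤ (T : ℝ) ^ k := by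
      rw [hdesc]; exact_mod_cast Nat.descFactorial_le_pow T k
    have h2 : ∑ i, (((M i + 1 - k : ℕ) : ℝ)) ^ k ≤ k.factorial * ∑ i, ((M i).choose k : ℝ) := by
      rw [Finset.mul_sum]
      refine Finset.sum_le_sum fun i _ => ?_
      rw [hdesc]
      exact_mod_cast Nat.pow_sub_le_descFactorial (M i) k
    have h3 : (T : ℝ) - m * k ≤ ∑ i, ((M i + 1 - k : ℕ) : ℝ) := by
      have : ∀ i, (M i : ℝ) - k ≤ ((M i + 1 - k : ℕ) : ℝ) := fun i => by
        have : M i ≤ (M i + 1 - k) + k := by omega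
        have : (M i : ℝ) ≤ ((M i + 1 - k : ℕ) : ℝ) + k := by exact_mod_cast this
        linarith
      calc (T : ℝ) - m * k = ∑ i, ((M i : ℝ) - k) := by
            rw [hT]; push_cast; simp [Finset.sum_sub_distrib]
        _ ≤ _ := Finset.sum_le_sum fun i _ => this i
    have h4 : (∑ i, ((M i + 1 - k : ℕ) : ℝ)) ^ k ≤
        (m : ℝ) ^ (k - 1) * ∑ i, (((M i + 1 - k : ℕ) : ℝ)) ^ k := by
      obtain ⟨l, rfl⟩ : ∃ l, k = l + 1 := ⟨k - 1, by omega⟩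
      have := pow_sum_div_card_le_sum_pow (s := Finset.univ)
        (f := fun i : Fin m => ((M i + 1 - (l + 1) : ℕ) : ℝ)) (fun i _ => by positivity) l
      rw [div_le_iff₀ (by simpa using pow_pos hmr l)] at this
      simp only [Finset.card_univ, Fintype.card_fin, add_tsub_cancel_right] at this ⊢
      linarith
    have hq : (m * k ^ 2 : ℝ) ≤ δ * T := by
      rw [div_le_iff₀ hδ0] at h; linarith
    have h5 : 0 ≤ (T : ℝ) - m * k := by
      have : (m : ℝ) * k ≤ m * k ^ 2 := by
        refine mul_le_mul_of_nonneg_left ?_ hmr.le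
        nlinarith
      nlinarith
    have h6 : (1 - δ) * (T : ℝ) ^ k ≤ (T - m * k : ℝ) ^ k := by
      have hb := one_add_mul_le_pow (a := -(m * k / T : ℝ)) (by
        have : (m * k / T : ℝ) ≤ 1 := by rw [div_le_one hTr]; linarith
        linarith) k
      have hb2 : 1 - δ ≤ 1 + k * -(m * k / T : ℝ) := by
        have : (k : ℝ) * (m * k / T) ≤ δ := by
          rw [← mul_div_assoc, div_le_iff₀ hTr]; nlinarith
        linarith
      calc (1 - δ) * (T : ℝ) ^ k ≤ (1 + -(m * k / T : ℝ)) ^ k * T ^ k := by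
            gcongr; exact hb2.trans hb
        _ = _ := by rw [← mul_pow]; congr 1; field_simp; ring
    have h7 : (T - m * k : ℝ) ^ k ≤ (∑ i, ((M i + 1 - k : ℕ) : ℝ)) ^ k :=
      pow_le_pow_left₀ h5 h3 k
    have h8 : k.factorial * ((1 - δ) * (T.choose k : ℝ)) ≤
        k.factorial * ((m : ℝ) ^ (k - 1) * ∑ i, ((M i).choose k : ℝ)) := by
      calc k.factorial * ((1 - δ) * (T.choose k : ℝ)) = (1 - δ) * (k.factorial * T.choose k) := by
            ring
        _ ≤ (1 - δ) * (T : ℝ) ^ k := mul_le_mul_of_nonneg_left h1 (by linarith)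
        _ ≤ (m : ℝ) ^ (k - 1) * ∑ i, (((M i + 1 - k : ℕ) : ℝ)) ^ k := h6.trans (h7.trans h4)
        _ ≤ (m : ℝ) ^ (k - 1) * (k.factorial * ∑ i, ((M i).choose k : ℝ)) := by gcongr
        _ = _ := by ring
    have := le_of_mul_le_mul_left h8 hfac
    linarith

/-- The clause intensity of the Poissonized model with about `a * n` clauses. -/
def tau (k n : ℕ) (a : ℝ) : ℝ := a * k.factorial / (2 ^ k * n ^ (k - 1))

lemma tau_nonneg {k n : ℕ} {a : ℝ} (ha : 0 ≤ a) : 0 ≤ tau k n a := by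
  unfold tau; positivity

lemma tau_mono {k n : ℕ} {a b : ℝ} (h : a ≤ b) : tau k n a ≤ tau k n b := by
  unfold tau; gcongr

/-- The error constant of the merging step. -/
def mergeConst (k m : ℕ) (δ : ℝ) : ℝ := k.factorial * (m * k ^ 2 / δ) ^ k

variable {n k : ℕ}

lemma sum_const_mul_violated {t : ℝ} {σ : Type*} (x : σ → Fin n → Bool) (a₀ : σ) :
    ∑ c : Clause n k, t * (if ∀ a, ¬ sat (x a) c then (1 : ℝ) else 0) =
      t * ((Finset.univ.filter fun i => ∀ a, x a i = x a₀ i).card.choose k : ℕ) := by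
  rw [← Finset.mul_sum, Finset.sum_boole, ← card_violated x a₀ Finset.univ]
  simp

lemma sum_block_violated (m : ℕ) (hk : 1 ≤ k) {σ : Type*} (x : σ → Fin (m * n) → Bool) (a₀ : σ) :
    ∑ i : Fin m, ((((Finset.univ.map (blockEmb m n i)).filter
        fun v => ∀ a, x a v = x a₀ v).card.choose k : ℕ) : ℝ) ≤
      ∑ c : Clause (m * n) k, (if c ∈ Set.range (blockClause m n hk) then (1 : ℝ) else 0) *
        (if ∀ a, ¬ sat (x a) c then 1 else 0) := by
  simp only [← ite_and, mul_ite, mul_one, mul_zero, ← card_violated x a₀, Finset.sum_boole]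
  rw [← Nat.cast_sum, Nat.cast_le, ← Finset.card_biUnion]
  · refine Finset.card_le_card fun c hc => ?_
    simp only [Finset.mem_biUnion, Finset.mem_univ, true_and, Finset.mem_filter] at hc ⊢
    obtain ⟨i, h1, h2⟩ := hc
    obtain ⟨d, hd⟩ := mem_range_clauseMap _ c h2
    exact ⟨h1, ⟨(i, d), hd⟩⟩
  · intro i _ j _ hij
    rw [Function.onFun, Finset.disjoint_left]
    intro c hc hc'
    simp only [Finset.mem_filter, Finset.mem_univ, true_and] at hc hc'
    have hne : c.vars.Nonempty := by
      rw [← Finset.card_pos]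
      have : c.vars.card = k := c.2.2
      omega
    obtain ⟨v, hv⟩ := hne
    obtain ⟨y, -, hy⟩ := Finset.mem_map.1 (hc.2 hv)
    obtain ⟨z, -, hz⟩ := Finset.mem_map.1 (hc'.2 hv)
    rw [← hz] at hy
    have : (i, y) = (j, z) := finProdFinEquiv.injective hy
    exact hij (congrArg Prod.fst this)

lemma merge_intensity_le {m : ℕ} (hk : 2 ≤ k) (hm : 1 ≤ m) (hn : 1 ≤ n) {a δ : ℝ} (ha : 0 ≤ a)
    (hδ0 : 0 < δ) (hδ1 : δ ≤ 1) {σ : Type*} (x : σ → Fin (m * n) → Bool) (a₀ : σ) :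
    ∑ c : Clause (m * n) k, (tau k (m * n) (a * (1 - δ)) -
        (if c ∈ Set.range (blockClause m n (one_le_two.trans hk)) then tau k n a else 0)) *
        (if ∀ a, ¬ sat (x a) c then (1 : ℝ) else 0) ≤
      a * mergeConst k m δ / (m * n) *
        if ∃ c : Clause (m * n) k, ∀ a, ¬ sat (x a) c then 1 else 0 := by
  set M : Fin m → ℕ := fun i => ((Finset.univ.map (blockEmb m n i)).filter
        fun v => ∀ a, x a v = x a₀ v).card with hM
  have hmr : (1 : ℝ) ≤ m := by exact_mod_cast hm
  have hnr : (1 : ℝ) ≤ n := by exact_mod_cast hn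
  have hblock := mul_le_mul_of_nonneg_left (sum_block_violated m (one_le_two.trans hk) x a₀)
    (tau_nonneg (k := k) (n := n) ha)
  split_ifs with hex
  · have hT : (Finset.univ.filter fun v => ∀ a, x a v = x a₀ v).card ≤ ∑ i, M i := by
      refine le_trans (Finset.card_le_card fun v hv => ?_) Finset.card_biUnion_le
      simp only [Finset.mem_filter, Finset.mem_univ, true_and, Finset.mem_biUnion,
        Finset.mem_map] at hv ⊢
      exact ⟨(finProdFinEquiv.symm v).1, ⟨(finProdFinEquiv.symm v).2,
        finProdFinEquiv.apply_symm_apply v⟩, hv⟩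
    have hnum := choose_sum_le (k := k) (one_le_two.trans hk) hδ0 hδ1 M
    set q : ℝ := a * k.factorial / (2 ^ k * (m * n) ^ (k - 1)) with hq
    have hq0 : 0 ≤ q := by positivity
    have hτ1 : tau k (m * n) (a * (1 - δ)) = q * (1 - δ) := by
      rw [tau, hq]; push_cast; ring
    have hτ2 : tau k n a = q * (m : ℝ) ^ (k - 1) := by
      rw [tau, hq, mul_pow]; field_simp
    have hqK : q * (m * k ^ 2 / δ) ^ k ≤ a * mergeConst k m δ / (m * n) := by
      have h1 : (m * n : ℝ) ≤ 2 ^ k * (m * n) ^ (k - 1) := by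
        have h1 : (1 : ℝ) ≤ m * n := one_le_mul_of_one_le_of_one_le hmr hnr
        calc (m * n : ℝ) = 1 * (m * n) ^ 1 := by ring
          _ ≤ _ := mul_le_mul (one_le_pow₀ (by norm_num))
            (pow_le_pow_right₀ h1 (by omega)) (by positivity) (by positivity)
      calc q * (m * k ^ 2 / δ) ^ k = a * mergeConst k m δ / (2 ^ k * (m * n) ^ (k - 1)) := by
            rw [hq, mergeConst]; ring
        _ ≤ _ := by
          refine div_le_div_of_nonneg_left ?_ (by positivity) h1
          unfold mergeConst
          positivity
    simp only [sub_mul, Finset.sum_sub_distrib, sum_const_mul_violated x a₀]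
    have hblock' : tau k n a * ∑ i, ((M i).choose k : ℝ) ≤ ∑ c : Clause (m * n) k,
        (if c ∈ Set.range (blockClause m n (one_le_two.trans hk)) then tau k n a else 0) *
        (if ∀ a, ¬ sat (x a) c then (1 : ℝ) else 0) := by
      refine hblock.trans_eq ?_
      rw [Finset.mul_sum]
      exact Finset.sum_congr rfl fun c _ => by split_ifs <;> simp
    have hch : (((Finset.univ.filter fun v => ∀ a, x a v = x a₀ v).card.choose k : ℕ) : ℝ) ≤
        ((∑ i, M i).choose k : ℕ) := by exact_mod_cast Nat.choose_le_choose k hT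
    have h9 : tau k (m * n) (a * (1 - δ)) *
        (((Finset.univ.filter fun v => ∀ a, x a v = x a₀ v).card.choose k : ℕ) : ℝ) ≤
        tau k n a * ∑ i, ((M i).choose k : ℝ) + a * mergeConst k m δ / (m * n) := by
      calc _ ≤ tau k (m * n) (a * (1 - δ)) * (((∑ i, M i).choose k : ℕ) : ℝ) :=
            mul_le_mul_of_nonneg_left hch (tau_nonneg (mul_nonneg ha (by linarith)))
        _ = q * ((1 - δ) * (((∑ i, M i).choose k : ℕ) : ℝ)) := by rw [hτ1]; ring
        _ ≤ q * ((m : ℝ) ^ (k - 1) * ∑ i, ((M i).choose k : ℝ) + (m * k ^ 2 / δ) ^ k) :=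
            mul_le_mul_of_nonneg_left hnum hq0
        _ ≤ _ := by rw [hτ2]; linarith
    linarith
  · push Not at hex
    rw [mul_zero]
    refine Finset.sum_nonpos fun c _ => ?_
    have : ¬ ∀ a, ¬ sat (x a) c := by push Not; exact hex c
    rw [if_neg this, mul_zero]

lemma W_blocks_rpow_le (m : ℕ) (hk1 : 1 ≤ k) {r : ℝ} (hr : 0 ≤ r)
    (G : Fin m → Finset (Clause n k)) :
    W ((finsetProdEquiv (Fin m) (Clause n k) G).map (blockClause m n hk1)) ^ (-r) ≤
      (2 ^ m) ^ r * ∏ i, W (G i) ^ (-r) +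
      (r * (m * (n + 1) * Real.log 2)) * ∑ i, if Z (G i) = 0 then (1 : ℝ) else 0 := by
  have hlog : 0 ≤ r * (m * (n + 1) * Real.log 2) := by
    have := Real.log_nonneg (x := 2) (by norm_num)
    positivity
  have hprod0 : 0 < ∏ i, W (G i) := Finset.prod_pos fun i _ => W_pos _
  rw [W, Z_blocks, Real.finsetProd_rpow _ _ fun i _ => (W_pos _).le]
  by_cases hz : ∃ i, Z (G i) = 0
  · obtain ⟨i, hi⟩ := hz
    have h2 : ∏ j, Z (G j) = 0 := Finset.prod_eq_zero (Finset.mem_univ i) hi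
    rw [h2]
    simp only [Nat.cast_zero, zero_add, Real.one_rpow]
    have h3 : (1 : ℝ) ≤ ∑ i, if Z (G i) = 0 then (1 : ℝ) else 0 := by
      refine le_trans (by rw [if_pos hi]) (Finset.single_le_sum
        (f := fun i => if Z (G i) = 0 then (1 : ℝ) else 0) (fun j _ => ?_) (Finset.mem_univ i))
      split_ifs <;> norm_num
    have h4 : 1 + -r * Real.log (∏ i, W (G i)) ≤ (∏ i, W (G i)) ^ (-r) := by
      rw [Real.rpow_def_of_pos hprod0]
      have := Real.add_one_le_exp (Real.log (∏ i, W (G i)) * -r)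
      linarith
    have h5 : Real.log (∏ i, W (G i)) ≤ m * (n + 1) * Real.log 2 := by
      rw [Real.log_prod fun i _ => (W_pos _).ne']
      calc ∑ i, Real.log (W (G i)) ≤ ∑ i : Fin m, ((n + 1 : ℕ) * Real.log 2) :=
            Finset.sum_le_sum fun i _ => by
              rw [← Real.log_pow]
              exact Real.log_le_log (W_pos _) (W_le _)
        _ = _ := by simp; ring
    have h6 : (1 : ℝ) ≤ (2 ^ m) ^ r := Real.one_le_rpow (one_le_pow₀ (by norm_num)) hr
    have h7 : 0 ≤ (∏ i, W (G i)) ^ (-r) := by positivity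
    nlinarith [mul_le_mul_of_nonneg_left h5 hr, mul_le_mul_of_nonneg_left h3 hlog]
  · push Not at hz
    have h2 : (∏ i, W (G i)) ≤ 2 ^ m * ((∏ i, Z (G i) : ℕ) + 1) := by
      calc (∏ i, W (G i)) ≤ ∏ i : Fin m, (2 * (Z (G i) : ℝ)) := by
            refine Finset.prod_le_prod (fun i _ => (W_pos _).le) fun i _ => ?_
            have : (1 : ℝ) ≤ Z (G i) := by exact_mod_cast Nat.one_le_iff_ne_zero.2 (hz i)
            rw [W]; linarith
        _ = 2 ^ m * (∏ i, Z (G i) : ℕ) := by simp [Finset.prod_mul_distrib]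
        _ ≤ _ := by gcongr; linarith
    set y : ℝ := ((∏ i, Z (G i) : ℕ) : ℝ) + 1 with hy
    have hy0 : 0 < y := by positivity
    have h3 : (0 : ℝ) ≤ ∑ i, if Z (G i) = 0 then (1 : ℝ) else 0 :=
      Finset.sum_nonneg fun i _ => by split_ifs <;> norm_num
    have h4 : y ^ (-r) ≤ (2 ^ m) ^ r * (∏ i, W (G i)) ^ (-r) := by
      have h5 : (∏ i, W (G i)) ^ r ≤ (2 ^ m) ^ r * y ^ r := by
        rw [← Real.mul_rpow (by positivity) hy0.le]
        exact Real.rpow_le_rpow hprod0.le h2 hr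
      have h6 : 0 < y ^ r := by positivity
      have h7 : 0 < (∏ i, W (G i)) ^ r := by positivity
      rw [Real.rpow_neg hy0.le, Real.rpow_neg hprod0.le, ← div_eq_mul_inv, inv_eq_one_div,
        div_le_div_iff₀ h6 h7]
      linarith
    have := mul_nonneg hlog h3
    linarith

lemma avg_blocks_le (m : ℕ) (hk1 : 1 ≤ k) {r t : ℝ} (hr : 0 ≤ r) (ht : 0 ≤ t) :
    avg (fun _ : Fin m × Clause n k => t) (fun F => W (F.map (blockClause m n hk1)) ^ (-r)) ≤
      (2 ^ m) ^ r * avg (fun _ : Clause n k => t) (fun F => W F ^ (-r)) ^ m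
      + m * avg (fun _ : Clause n k => t) (fun F => if Z F = 0 then 1 else 0)
        * (r * (m * (n + 1) * Real.log 2)) := by
  have h := avg_prod (κ := Fin m) (fun _ : Clause n k => t)
    (fun F => W (F.map (blockClause m n hk1)) ^ (-r))
  rw [h]
  set w : (Fin m → Finset (Clause n k)) → ℝ := fun G => ∏ i, wgt (fun _ => t) (G i) with hw
  have hw0 : ∀ G, 0 ≤ w G := fun G => Finset.prod_nonneg fun i _ => wgt_nonneg (fun _ => ht) _
  set q : ℝ := r * (m * (n + 1) * Real.log 2)
  have h1 : ∑ G, w G * ∏ i, W (G i) ^ (-r) =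
      avg (fun _ : Clause n k => t) (fun F => W F ^ (-r)) ^ m := by
    simpa using sum_prod_wgt_mul_prod (κ := Fin m) (fun _ : Clause n k => t)
      (fun _ F => W F ^ (-r))
  have h2 : ∀ j, ∑ G, w G * (if Z (G j) = 0 then (1 : ℝ) else 0) =
      avg (fun _ : Clause n k => t) (fun F => if Z F = 0 then 1 else 0) := fun j =>
    sum_prod_wgt_mul_single (fun _ : Clause n k => t) j (fun F => if Z F = 0 then (1 : ℝ) else 0)
  calc ∑ G, w G * W ((finsetProdEquiv (Fin m) (Clause n k) G).map (blockClause m n hk1)) ^ (-r)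
      ≤ ∑ G, w G * ((2 ^ m) ^ r * ∏ i, W (G i) ^ (-r) +
          q * ∑ i, if Z (G i) = 0 then (1 : ℝ) else 0) :=
        Finset.sum_le_sum fun G _ =>
          mul_le_mul_of_nonneg_left (W_blocks_rpow_le m hk1 hr G) (hw0 G)
    _ = (2 ^ m) ^ r * ∑ G, w G * ∏ i, W (G i) ^ (-r) +
        q * ∑ j, ∑ G, w G * (if Z (G j) = 0 then (1 : ℝ) else 0) := by
        rw [Finset.sum_comm, Finset.mul_sum, Finset.mul_sum, ← Finset.sum_add_distrib]
        refine Finset.sum_congr rfl fun G _ => ?_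
        rw [← Finset.mul_sum]
        ring
    _ = _ := by
        rw [h1, Finset.sum_congr rfl fun j _ => h2 j]
        simp only [Finset.sum_const, Finset.card_univ, Fintype.card_fin, nsmul_eq_mul]
        ring

/-- The effect of merging `m` blocks of size `n` on the mean of `W ^ (-r)`. -/
lemma avg_merge_le {m : ℕ} (hk : 2 ≤ k) (hm : 1 ≤ m) (hn : 1 ≤ n) {a δ r : ℝ} (ha : 0 ≤ a)
    (hδ0 : 0 < δ) (hδ1 : δ ≤ 1) (hr : 0 ≤ r) :
    avg (fun _ : Clause (m * n) k => tau k (m * n) (a * (1 - δ))) (fun F => W F ^ (-r)) ≤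
      (2 ^ m) ^ r * avg (fun _ : Clause n k => tau k n a) (fun F => W F ^ (-r)) ^ m
      + m * avg (fun _ : Clause n k => tau k n a) (fun F => if Z F = 0 then 1 else 0)
        * (r * (m * (n + 1) * Real.log 2))
      + 2 * (a * mergeConst k m δ / (m * n)) *
        ((4 ^ (m * n) * 2 ^ (m * n + 1)) ^ r - 1) := by
  have hk1 : 1 ≤ k := one_le_two.trans hk
  set mu : Clause (m * n) k → ℝ := fun c =>
    if c ∈ Set.range (blockClause m n hk1) then tau k n a else 0 with hmu
  have hmc : 0 ≤ mergeConst k m δ := by unfold mergeConst; positivity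
  have hτ := tau_nonneg (k := k) (n := n) ha
  have hmu0 : ∀ c, 0 ≤ mu c := fun c => by
    simp only [hmu]; split_ifs; exacts [hτ, le_rfl]
  have hdrift := drift_le (lam := fun _ : Clause (m * n) k => tau k (m * n) (a * (1 - δ)))
    (mu := mu) (κ := a * mergeConst k m δ / (m * n)) hr (by positivity) fun l x => by
      have := merge_intensity_le hk hm hn ha hδ0 hδ1 x 0
      convert! this
  refine (avg_le_avg_add (mu := mu) (fun _ => tau_nonneg (mul_nonneg ha (by linarith))) hmu0
    hdrift).trans ?_
  refine add_le_add_left ?_ _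
  rw [avg_eq_avg_map (blockClause m n hk1) (lam := mu) (fun c hc => if_neg hc)]
  have h1 : (fun p => mu (blockClause m n hk1 p)) = fun _ => tau k n a := by
    funext p; exact if_pos ⟨p, rfl⟩
  rw [h1]
  exact avg_blocks_le m hk1 hr hτ

end Merge

section Rate

/-- The mean of `W ^ (-r)` in the Poissonized model. -/
def negMoment (k n : ℕ) (a r : ℝ) : ℝ :=
  avg (fun _ : Clause n k => tau k n a) fun F => W F ^ (-r)

/-- The probability of unsatisfiability in the Poissonized model. -/
def unsatProb (k n : ℕ) (a : ℝ) : ℝ :=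
  avg (fun _ : Clause n k => tau k n a) fun F => if Z F = 0 then 1 else 0

/-- The normalized cumulant of `log W`. -/
def rate (k n : ℕ) (a r : ℝ) : ℝ := -Real.log (negMoment k n a r) / (r * n)

variable {k n : ℕ} {a r : ℝ}

lemma unsatProb_nonneg (ha : 0 ≤ a) : 0 ≤ unsatProb k n a := by
  have := avg_mono (fun _ : Clause n k => tau_nonneg (k := k) (n := n) ha)
    (g := fun _ => 0) (h := fun F => if Z F = 0 then 1 else 0) fun F => by split_ifs <;> norm_num
  rwa [avg_const] at this

lemma unsatProb_mono {b : ℝ} (ha : 0 ≤ a) (hab : a ≤ b) : unsatProb k n a ≤ unsatProb k n b :=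
  avg_le_of_monotone (fun _ => tau_nonneg ha) (fun _ => tau_mono hab) fun F G hFG => by
    have := Z_antitone hFG
    split_ifs <;> first | omega | norm_num

lemma rpow_le_negMoment (ha : 0 ≤ a) (hr : 0 ≤ r) :
    ((2 : ℝ) ^ (n + 1)) ^ (-r) ≤ negMoment k n a r := by
  have := avg_mono (fun _ : Clause n k => tau_nonneg (k := k) (n := n) ha)
    (g := fun _ => ((2 : ℝ) ^ (n + 1)) ^ (-r)) (h := fun F => W F ^ (-r)) fun F =>
      Real.rpow_le_rpow_of_nonpos (W_pos F) (W_le F) (by linarith)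
  rwa [avg_const] at this

lemma negMoment_pos (ha : 0 ≤ a) (hr : 0 ≤ r) : 0 < negMoment k n a r :=
  lt_of_lt_of_le (by positivity) (rpow_le_negMoment ha hr)

lemma rpow_neg_W_monotone (hr : 0 ≤ r) :
    Monotone fun F : Finset (Clause n k) => W F ^ (-r) := fun F G hFG => by
  refine Real.rpow_le_rpow_of_nonpos (W_pos G) ?_ (by linarith)
  have : (Z G : ℝ) ≤ Z F := by exact_mod_cast Z_antitone hFG
  simpa [W] using this

lemma negMoment_mono {b : ℝ} (ha : 0 ≤ a) (hab : a ≤ b) (hr : 0 ≤ r) :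
    negMoment k n a r ≤ negMoment k n b r :=
  avg_le_of_monotone (fun _ => tau_nonneg ha) (fun _ => tau_mono hab) (rpow_neg_W_monotone hr)

lemma rate_antitone {b : ℝ} (ha : 0 ≤ a) (hab : a ≤ b) (hr : 0 ≤ r) :
    rate k n b r ≤ rate k n a r := by
  unfold rate
  have := Real.log_le_log (negMoment_pos (k := k) (n := n) ha hr) (negMoment_mono ha hab hr)
  gcongr

lemma sixteen_rpow_sub_one_le {x θ : ℝ} (hx : 0 ≤ x) (hxθ : x ≤ θ) :
    (16 : ℝ) ^ x - 1 ≤ 3 * x * 16 ^ θ := by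
  have hlog : Real.log 16 ≤ 3 := by
    rw [show (16 : ℝ) = 2 ^ 4 by norm_num, Real.log_pow]
    have := Real.log_two_lt_d9
    push_cast
    linarith
  have hlog0 : 0 ≤ Real.log 16 := Real.log_nonneg (by norm_num)
  have h1 : (16 : ℝ) ^ x - 1 ≤ (Real.log 16 * x) * 16 ^ x := by
    rw [Real.rpow_def_of_pos (by norm_num)]
    set y := Real.log 16 * x
    have h := Real.add_one_le_exp (-y)
    have h2 : Real.exp (-y) * Real.exp y = 1 := by rw [← Real.exp_add]; simp
    nlinarith [Real.exp_pos y]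
  have h2 : (16 : ℝ) ^ x ≤ 16 ^ θ := Real.rpow_le_rpow_of_exponent_le (by norm_num) hxθ
  calc (16 : ℝ) ^ x - 1 ≤ (Real.log 16 * x) * 16 ^ x := h1
    _ ≤ (3 * x) * 16 ^ θ := by gcongr

lemma mergeConst_nonneg (k m : ℕ) {δ : ℝ} (hδ : 0 ≤ δ) : 0 ≤ mergeConst k m δ := by
  unfold mergeConst; positivity

lemma four_mul_two_rpow_le {m n : ℕ} (hm : 1 ≤ m) (hn : 1 ≤ n) {r θ : ℝ} (hr : 0 ≤ r)
    (hθ : r * (m * n) ≤ θ) :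
    ((4 : ℝ) ^ (m * n) * 2 ^ (m * n + 1)) ^ r - 1 ≤ 3 * (r * (m * n)) * 16 ^ θ := by
  have hx0 : 0 ≤ r * (m * n) := by positivity
  set x : ℝ := r * (m * n) with hx
  refine le_trans (sub_le_sub_right ?_ 1) (sixteen_rpow_sub_one_le hx0 hθ)
  have : (16 : ℝ) ^ x = ((16 : ℝ) ^ (m * n)) ^ r := by
    rw [← Real.rpow_natCast, ← Real.rpow_mul (by norm_num), hx]
    push_cast
    ring_nf
  rw [this]
  refine Real.rpow_le_rpow (by positivity) ?_ hr
  have h2 : (2 : ℝ) ^ (m * n + 1) ≤ 4 ^ (m * n) := by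
    rw [show (4 : ℝ) = 2 ^ 2 by norm_num, ← pow_mul]
    refine pow_le_pow_right₀ (by norm_num) ?_
    have : 1 ≤ m * n := Nat.one_le_iff_ne_zero.2 (by positivity)
    omega
  calc (4 : ℝ) ^ (m * n) * 2 ^ (m * n + 1) ≤ 4 ^ (m * n) * 4 ^ (m * n) := by gcongr
    _ = 16 ^ (m * n) := by rw [← mul_pow]; norm_num

lemma negMoment_merge {m : ℕ} (hk : 2 ≤ k) (hm : 1 ≤ m) (hn : 1 ≤ n) {δ θ : ℝ} (ha : 0 ≤ a)
    (hδ0 : 0 < δ) (hδ1 : δ ≤ 1) (hr : 0 < r) (hθ : r * (m * n) ≤ θ) :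
    negMoment k (m * n) (a * (1 - δ)) r ≤ (2 ^ m) ^ r * negMoment k n a r ^ m +
      r * (m * n) * (2 * (m * unsatProb k n a) +
        6 * (a * mergeConst k m δ) / n * 16 ^ θ) := by
  have hmr : (1 : ℝ) ≤ m := by exact_mod_cast hm
  have hnr : (1 : ℝ) ≤ n := by exact_mod_cast hn
  have hK0 : 0 ≤ a * mergeConst k m δ := mul_nonneg ha (mergeConst_nonneg k m hδ0.le)
  have hU := unsatProb_nonneg (k := k) (n := n) ha
  have h16 := four_mul_two_rpow_le hm hn hr.le hθ
  refine (avg_merge_le (k := k) hk hm hn ha hδ0 hδ1 hr.le).trans ?_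
  rw [← negMoment, ← unsatProb]
  generalize a * mergeConst k m δ = K at *
  generalize unsatProb k n a = U at *
  generalize negMoment k n a r = A at *
  have hx0 : 0 < r * (m * n) := by positivity
  set x : ℝ := r * (m * n) with hx
  have h1 : m * U * (r * (m * (n + 1) * Real.log 2)) ≤ x * (2 * (m * U)) := by
    have hl : Real.log 2 ≤ 1 := by linarith [Real.log_two_lt_d9]
    have : (n + 1) * Real.log 2 ≤ 2 * n := by
      have := Real.log_nonneg (x := 2) (by norm_num)
      nlinarith
    have hc : 0 ≤ m * U * r * m := by positivity
    calc m * U * (r * (m * (n + 1) * Real.log 2)) = m * U * r * m * ((n + 1) * Real.log 2) := by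
          ring
      _ ≤ m * U * r * m * (2 * n) := by gcongr
      _ = _ := by rw [hx]; ring
  have h2 : 2 * (K / (m * n)) * (((4 : ℝ) ^ (m * n) * 2 ^ (m * n + 1)) ^ r - 1) ≤
      x * (6 * K / n * 16 ^ θ) := by
    calc _ ≤ 2 * (K / n) * (3 * x * 16 ^ θ) := by
          refine mul_le_mul ?_ h16 ?_ (by positivity)
          · have : K / (m * n) ≤ K / n :=
              div_le_div_of_nonneg_left hK0 (by linarith) (by nlinarith)
            linarith
          · have : (1 : ℝ) ≤ (4 ^ (m * n) * 2 ^ (m * n + 1)) ^ r := by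
              refine Real.one_le_rpow (one_le_mul_of_one_le_of_one_le ?_ ?_) hr.le <;>
              exact one_le_pow₀ (by norm_num)
            linarith
      _ = _ := by ring
  linarith

lemma rpow_le_negMoment_pow {m : ℕ} (hn : 1 ≤ n) {θ : ℝ} (ha : 0 ≤ a) (hr : 0 ≤ r)
    (hθ : r * (m * n) ≤ θ) : (4 : ℝ) ^ (-θ) ≤ negMoment k n a r ^ m := by
  refine le_trans ?_ (pow_le_pow_left₀ (by positivity) (rpow_le_negMoment ha hr) m)
  have h1 : (4 : ℝ) ^ (-θ) = 2 ^ (-(2 * θ)) := by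
    rw [show -(2 * θ) = 2 * -θ by ring, Real.rpow_mul (by norm_num)]
    norm_num
  have h2 : (((2 : ℝ) ^ (n + 1)) ^ (-r)) ^ m = 2 ^ (((n + 1 : ℕ) : ℝ) * -r * m) := by
    rw [Real.rpow_mul (by norm_num), Real.rpow_mul (by norm_num), Real.rpow_natCast,
      Real.rpow_natCast]
  rw [h1, h2]
  refine Real.rpow_le_rpow_of_exponent_le (by norm_num) ?_
  have hnr : (1 : ℝ) ≤ n := by exact_mod_cast hn
  have h3 : 0 ≤ r * m := by positivity
  push_cast
  nlinarith

lemma log_le_of_le_add {A A' x E r θ : ℝ} {m : ℕ} (hA : 0 < A) (hA' : 0 < A') (hx : 0 ≤ x)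
    (hE0 : 0 ≤ E) (hr : 0 ≤ r) (hAm : (4 : ℝ) ^ (-θ) ≤ A ^ m)
    (hE : A' ≤ (2 ^ m) ^ r * A ^ m + x * E) :
    Real.log A' ≤ m * Real.log A + r * m + x * (4 ^ θ * E) := by
  have h2m : (1 : ℝ) ≤ (2 ^ m) ^ r := Real.one_le_rpow (one_le_pow₀ (by norm_num)) hr
  have hc0 : 0 < (2 ^ m) ^ r * A ^ m := by positivity
  have hcA : A ^ m ≤ (2 ^ m) ^ r * A ^ m := le_mul_of_one_le_left (by positivity) h2m
  have h3 : A' ≤ (2 ^ m) ^ r * A ^ m * Real.exp (x * (4 ^ θ * E)) := by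
    refine hE.trans ?_
    generalize (2 ^ m) ^ r * A ^ m = c at *
    have h4 : 1 ≤ 4 ^ θ * c := by
      have : (1 : ℝ) = 4 ^ θ * 4 ^ (-θ) := by
        rw [← Real.rpow_add (by norm_num)]; simp
      rw [this]
      gcongr
      exact hAm.trans hcA
    have h5 := Real.add_one_le_exp (x * (4 ^ θ * E))
    calc c + x * E = c + 1 * (x * E) := by ring
      _ ≤ c + (4 ^ θ * c) * (x * E) := by gcongr
      _ = c * (x * (4 ^ θ * E) + 1) := by ring
      _ ≤ _ := by gcongr
  have h6 := Real.log_le_log hA' h3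
  rw [Real.log_mul hc0.ne' (Real.exp_ne_zero _), Real.log_exp,
    Real.log_mul (by positivity) (by positivity), Real.log_rpow (by positivity), Real.log_pow,
    Real.log_pow] at h6
  have hl : Real.log 2 ≤ 1 := by linarith [Real.log_two_lt_d9]
  have : r * (m * Real.log 2) ≤ r * m := by
    rw [← mul_assoc]
    exact mul_le_of_le_one_right (by positivity) hl
  linarith

lemma merge_error_le {K U θ m n : ℝ} (hn : 0 < n) (hm : 0 ≤ m) (hU : 0 ≤ U) (hθ0 : 0 ≤ θ) :
    1 / n + 4 ^ θ * (2 * (m * U) + 6 * K / n * 16 ^ θ) ≤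
      6 * 64 ^ θ * ((1 + K) / n + m * U) := by
  have h4θ : (4 : ℝ) ^ θ ≤ 64 ^ θ := Real.rpow_le_rpow (by norm_num) (by norm_num) hθ0
  have h64 : (64 : ℝ) ^ θ = 4 ^ θ * 16 ^ θ := by
    rw [← Real.mul_rpow (by norm_num) (by norm_num)]; norm_num
  have h1θ : (1 : ℝ) ≤ 64 ^ θ := Real.one_le_rpow (by norm_num) hθ0
  have h7 : 4 ^ θ * (2 * (m * U) + 6 * K / n * 16 ^ θ) =
      2 * (m * U) * 4 ^ θ + 6 * (K / n) * 64 ^ θ := by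
    rw [h64]; ring
  rw [h7, add_div]
  have h8 : 0 ≤ m * U := by positivity
  have h9 : 0 ≤ 1 / n := by positivity
  nlinarith [mul_le_mul_of_nonneg_left h4θ h8, mul_le_mul_of_nonneg_left h1θ h9]

/-- Merging `m` blocks hardly decreases the rate. -/
lemma rate_merge {m : ℕ} (hk : 2 ≤ k) (hm : 1 ≤ m) (hn : 1 ≤ n) {δ θ : ℝ} (ha : 0 ≤ a)
    (hδ0 : 0 < δ) (hδ1 : δ ≤ 1) (hr : 0 < r) (hθ : r * (m * n) ≤ θ) :
    rate k n a r - 6 * 64 ^ θ * ((1 + a * mergeConst k m δ) / n + m * unsatProb k n a) ≤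
      rate k (m * n) (a * (1 - δ)) r := by
  have hmr : (0 : ℝ) < m := by exact_mod_cast hm
  have hnr : (0 : ℝ) < n := by exact_mod_cast hn
  have hU := unsatProb_nonneg (k := k) (n := n) ha
  have hK0 : 0 ≤ a * mergeConst k m δ := mul_nonneg ha (mergeConst_nonneg k m hδ0.le)
  have hx0 : 0 < r * (m * n) := by positivity
  have hE := negMoment_merge (k := k) hk hm hn ha hδ0 hδ1 hr hθ
  have hA' := negMoment_pos (k := k) (n := m * n) (a := a * (1 - δ))
    (mul_nonneg ha (by linarith)) hr.le
  have hAm := rpow_le_negMoment_pow (k := k) hn ha hr.le hθ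
  have hA := negMoment_pos (k := k) (n := n) ha hr.le
  rw [rate, rate]
  generalize a * mergeConst k m δ = K at *
  generalize unsatProb k n a = U at *
  generalize negMoment k n a r = A at *
  generalize negMoment k (m * n) (a * (1 - δ)) r = A' at *
  have hlog := log_le_of_le_add hA hA' hx0.le (by positivity) hr.le hAm hE
  have hfin := merge_error_le (K := K) hnr hmr.le hU (hx0.le.trans hθ)
  generalize 4 ^ θ * (2 * (m * U) + 6 * K / n * 16 ^ θ) = E at *
  have h10 : -Real.log A / (r * n) - (1 / n + E) =
      -(m * Real.log A + r * m + r * (m * n) * E) / (r * (m * n)) := by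
    field_simp
    ring
  calc _ ≤ -Real.log A / (r * n) - (1 / n + E) := by linarith
    _ = _ := h10
    _ ≤ _ := by push_cast; gcongr

end Rate

section Chain

variable {k n : ℕ} {a r : ℝ}

/-- The binary logarithm of the number of solutions (zero for unsatisfiable formulas). -/
def entropy (F : Finset (Clause n k)) : ℝ := Real.logb 2 (max (Z F) 1)

/-- The mean entropy per variable in the Poissonized model. -/
def meanEntropy (k n : ℕ) (a : ℝ) : ℝ := avg (fun _ : Clause n k => tau k n a) entropy / n

lemma entropy_nonneg (F : Finset (Clause n k)) : 0 ≤ entropy F :=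
  Real.logb_nonneg (by norm_num) (le_max_right _ _)

lemma entropy_le (F : Finset (Clause n k)) : entropy F ≤ n := by
  rw [entropy, Real.logb_le_iff_le_rpow (by norm_num) (by positivity), Real.rpow_natCast]
  refine max_le ?_ (one_le_pow₀ (by norm_num))
  exact_mod_cast Z_le F

lemma entropy_antitone : Antitone (entropy : Finset (Clause n k) → ℝ) := fun F G hFG => by
  refine Real.logb_le_logb_of_le (by norm_num) (by positivity) (max_le_max_right _ ?_)
  exact_mod_cast Z_antitone hFG

lemma exp_neg_le {y : ℝ} (hy : 0 ≤ y) : Real.exp (-y) ≤ 1 - y + y ^ 2 := by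
  rcases le_or_gt y 1 with h | h
  · have := Real.abs_exp_sub_one_sub_id_le (x := -y) (by rwa [abs_neg, abs_of_nonneg hy])
    have := (abs_le.1 this).2
    linarith [neg_sq y]
  · have : Real.exp (-y) ≤ 1 := Real.exp_le_one_iff.2 (by linarith)
    nlinarith

/-- For small `r` the rate is at least the mean entropy. -/
lemma meanEntropy_le_rate (hn : 1 ≤ n) (ha : 0 ≤ a) (hr : 0 < r) :
    Real.log 2 * meanEntropy k n a - 4 * r * n ≤ rate k n a r := by
  have hnr : (1 : ℝ) ≤ n := by exact_mod_cast hn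
  have hl : 0 < Real.log 2 := Real.log_pos (by norm_num)
  have hl1 : Real.log 2 ≤ 1 := by linarith [Real.log_two_lt_d9]
  have hpt : ∀ F : Finset (Clause n k),
      W F ^ (-r) ≤ (1 + 4 * r ^ 2 * n ^ 2) + (-(r * Real.log 2)) * entropy F := fun F => by
    have h1 : Real.log (W F) ≤ 2 * n := by
      refine (Real.log_le_log (W_pos F) (W_le F)).trans ?_
      rw [Real.log_pow]
      push_cast
      nlinarith
    have h2 : Real.log 2 * entropy F ≤ Real.log (W F) := by
      rw [entropy, Real.logb, mul_div_cancel₀ _ hl.ne']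
      exact Real.log_le_log (by positivity) (max_le (by simp [W]) (one_le_W F))
    have h3 : 0 ≤ Real.log (W F) := Real.log_nonneg (one_le_W F)
    have h4 : W F ^ (-r) = Real.exp (-(r * Real.log (W F))) := by
      rw [Real.rpow_def_of_pos (W_pos F)]; ring_nf
    have h5 := exp_neg_le (mul_nonneg hr.le h3)
    have h6 : (r * Real.log (W F)) ^ 2 ≤ (r * (2 * n)) ^ 2 := by gcongr
    rw [h4]
    nlinarith [mul_le_mul_of_nonneg_left h2 hr.le]
  have hA : negMoment k n a r ≤ (1 + 4 * r ^ 2 * n ^ 2) +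
      (-(r * Real.log 2)) * (n * meanEntropy k n a) := by
    have h := avg_mono (fun _ : Clause n k => tau_nonneg (k := k) (n := n) ha) hpt
    rw [avg_add, avg_const, avg_const_mul] at h
    refine h.trans_eq ?_
    rw [meanEntropy, mul_div_cancel₀ _ (by positivity)]
  have hlog := Real.log_le_sub_one_of_pos (negMoment_pos (k := k) (n := n) ha hr.le)
  rw [rate, le_div_iff₀ (by positivity)]
  nlinarith

/-- The densities along a sequence of doublings. -/
def doublingDensity (a δ : ℝ) : ℕ → ℝ
  | 0 => a
  | j + 1 => doublingDensity a δ j * (1 - δ / ((j + 1) * (j + 2)))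

lemma doublingDensity_mem {δ : ℝ} (ha : 0 ≤ a) (hδ0 : 0 ≤ δ) (hδ1 : δ ≤ 1) (j : ℕ) :
    a * (1 - δ + δ / (j + 1)) ≤ doublingDensity a δ j ∧ doublingDensity a δ j ≤ a := by
  induction j with
  | zero => simp [doublingDensity]
  | succ j ih =>
    obtain ⟨h1, h2⟩ := ih
    have hj : (0 : ℝ) ≤ j := by positivity
    have hs0 : 0 ≤ δ / (((j : ℝ) + 1) * (j + 2)) := by positivity
    have hs1 : δ / (((j : ℝ) + 1) * (j + 2)) ≤ 1 := by
      rw [div_le_one (by positivity)]; nlinarith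
    have ht : δ / ((j : ℝ) + 1) ≤ δ := div_le_self hδ0 (by linarith)
    have ht0 : 0 ≤ δ / ((j : ℝ) + 1) := by positivity
    have hd0 : 0 ≤ doublingDensity a δ j := le_trans (mul_nonneg ha (by linarith)) h1
    have hid : δ / ((j : ℝ) + 1) - δ / (((j : ℝ) + 1) * (j + 2)) = δ / ((j + 1 : ℕ) + 1 : ℝ) := by
      push_cast; field_simp; ring
    rw [doublingDensity, ← hid]
    set s := δ / (((j : ℝ) + 1) * (j + 2))
    set t := δ / ((j : ℝ) + 1)
    constructor
    · calc a * (1 - δ + (t - s)) ≤ a * (1 - δ + t) * (1 - s) := by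
            rw [mul_assoc]
            refine mul_le_mul_of_nonneg_left ?_ ha
            nlinarith
        _ ≤ _ := mul_le_mul_of_nonneg_right h1 (by linarith)
    · nlinarith

/-- The error made in the `j`-th doubling of a system of size `n`. -/
def doublingError (k n : ℕ) (a δ : ℝ) (j : ℕ) : ℝ :=
  (1 + a * mergeConst k 2 (δ / ((j + 1) * (j + 2)))) / (2 ^ j * n) +
    2 * unsatProb k (2 ^ j * n) a

lemma rate_doubling (hk : 2 ≤ k) (hn : 1 ≤ n) (ha : 0 ≤ a) {δ θ : ℝ} (hδ0 : 0 < δ) (hδ1 : δ ≤ 1)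
    (hr : 0 < r) (J : ℕ) (hθ : r * (2 ^ J * n) ≤ θ) :
    rate k n a r - 6 * 64 ^ θ * ∑ j ∈ Finset.range J, doublingError k n a δ j ≤
      rate k (2 ^ J * n) (doublingDensity a δ J) r := by
  induction J with
  | zero => simp [doublingDensity]
  | succ J ih =>
    have hnr : (1 : ℝ) ≤ n := by exact_mod_cast hn
    have hp : (0 : ℝ) < 2 ^ J := by positivity
    have hθ' : r * (2 ^ J * n) ≤ θ := by
      refine le_trans ?_ hθ
      rw [pow_succ]
      have : 0 < r * (2 ^ J * n) := by positivity
      nlinarith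
    have ih := ih hθ'
    obtain ⟨hd1, hd2⟩ := doublingDensity_mem ha hδ0.le hδ1 J
    have hd0 : 0 ≤ doublingDensity a δ J := by
      refine le_trans (mul_nonneg ha ?_) hd1
      have : 0 ≤ δ / ((J : ℝ) + 1) := by positivity
      linarith
    have hs0 : 0 < δ / (((J : ℝ) + 1) * (J + 2)) := by positivity
    have hs1 : δ / (((J : ℝ) + 1) * (J + 2)) ≤ 1 := by
      rw [div_le_one (by positivity)]
      have : (0 : ℝ) ≤ J := by positivity
      nlinarith
    have hstep := rate_merge (k := k) (m := 2) (n := 2 ^ J * n) (θ := θ) hk (by norm_num)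
      (Nat.mul_pos (by positivity) hn) hd0 hs0 hs1 hr (by
        refine le_of_eq_of_le ?_ hθ
        push_cast
        ring)
    have hsize : 2 ^ (J + 1) * n = 2 * (2 ^ J * n) := by ring
    rw [hsize, doublingDensity, Finset.sum_range_succ]
    have herr : (1 + doublingDensity a δ J * mergeConst k 2 (δ / (((J : ℝ) + 1) * (J + 2)))) /
        ((2 ^ J * n : ℕ) : ℝ) + (2 : ℕ) * unsatProb k (2 ^ J * n) (doublingDensity a δ J) ≤
        doublingError k n a δ J := by
      have h1 := unsatProb_mono (k := k) (n := 2 ^ J * n) hd0 hd2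
      have h2 := mergeConst_nonneg k 2 hs0.le
      rw [doublingError]
      push_cast
      gcongr
    have hc : (0 : ℝ) ≤ 6 * 64 ^ θ := by positivity
    have := mul_le_mul_of_nonneg_left herr hc
    linarith

lemma summable_doubling (k : ℕ) (a δ : ℝ) : Summable fun j : ℕ =>
    (1 + a * mergeConst k 2 (δ / (((j : ℝ) + 1) * (j + 2)))) * (1 / 2 : ℝ) ^ j := by
  have h1 : Summable fun j : ℕ => (1 / 2 : ℝ) ^ j := summable_geometric_two
  have h2 : Summable fun j : ℕ => (((j : ℝ) + 1) * (j + 2)) ^ k * (1 / 2 : ℝ) ^ j := by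
    have h3 := ((summable_nat_add_iff 2).2 (summable_pow_mul_geometric_of_norm_lt_one (2 * k)
      (r := (1 / 2 : ℝ)) (by norm_num))).mul_left 4
    refine Summable.of_nonneg_of_le (fun j => by positivity) (fun j => ?_) h3
    have : (((j : ℝ) + 1) * (j + 2)) ^ k ≤ (((j + 2 : ℕ) : ℝ)) ^ (2 * k) := by
      rw [pow_mul]
      push_cast
      gcongr
      nlinarith
    calc _ ≤ (((j + 2 : ℕ) : ℝ)) ^ (2 * k) * (1 / 2 : ℝ) ^ j := by gcongr
      _ = _ := by rw [pow_add]; ring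
  refine (h1.add (h2.mul_left (a * (k.factorial * (2 * k ^ 2 / δ) ^ k)))).congr fun j => ?_
  have h4 : (2 * (k : ℝ) ^ 2) / (δ / (((j : ℝ) + 1) * (j + 2))) =
      2 * k ^ 2 / δ * (((j : ℝ) + 1) * (j + 2)) := by
    rw [div_div_eq_mul_div, mul_div_right_comm]
  rw [mergeConst, Nat.cast_two, h4, mul_pow (2 * (k : ℝ) ^ 2 / δ)]
  ring

/-- The accumulated error of all doublings is small once the initial size is large. -/
lemma eventually_sum_doublingError_le (ha : 0 ≤ a) {δ ε C : ℝ} (hδ : 0 < δ) (hε : 0 < ε)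
    (hU : ∀ᶠ n : ℕ in atTop, unsatProb k n a ≤ C / Real.log n ^ (1 + ε)) {η : ℝ} (hη : 0 < η) :
    ∀ᶠ n : ℕ in atTop, ∀ J, ∑ j ∈ Finset.range J, doublingError k n a δ j ≤ η := by
  set f : ℕ → ℝ := fun j => (1 + a * mergeConst k 2 (δ / (((j : ℝ) + 1) * (j + 2)))) *
    (1 / 2 : ℝ) ^ j with hf
  have hf0 : ∀ j, 0 ≤ f j := fun j => by
    have := mergeConst_nonneg k 2 (δ := δ / (((j : ℝ) + 1) * (j + 2))) (by positivity)
    positivity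
  have hfs : Summable f := summable_doubling k a δ
  set g : ℕ → ℝ := fun j => 1 / (j : ℝ) ^ (1 + ε) with hg
  have hgs : Summable g := Real.summable_one_div_nat_rpow.2 (by linarith)
  set D : ℝ := 2 * |C| / Real.log 2 ^ (1 + ε) with hD
  have hl : 0 < Real.log 2 := Real.log_pos (by norm_num)
  have hD0 : 0 ≤ D := by positivity
  have h1 : ∀ᶠ n : ℕ in atTop, (∑' j, f j) / n ≤ η / 2 :=
    (tendsto_const_div_atTop_nhds_zero_nat _).eventually_le_const (by positivity)
  have hlogt : Tendsto (fun n => Nat.log 2 n) atTop atTop :=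
    tendsto_atTop.2 fun b => by
    filter_upwards [eventually_ge_atTop (2 ^ b)] with n hn
    exact Nat.le_log_of_pow_le (by norm_num) hn
  have h2 : ∀ᶠ n : ℕ in atTop, D * ∑' j, g (j + Nat.log 2 n) ≤ η / 2 := by
    have := ((tendsto_sum_nat_add g).comp hlogt).const_mul D
    rw [mul_zero] at this
    exact this.eventually_le_const (by positivity)
  obtain ⟨n₁, hn₁⟩ := eventually_atTop.1 hU
  filter_upwards [h1, h2, eventually_ge_atTop n₁, eventually_ge_atTop 2] with n h1 h2 hn hn2 J
  have hnr : (0 : ℝ) < n := by positivity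
  have hterm : ∀ j, doublingError k n a δ j ≤ f j / n + D * g (j + Nat.log 2 n) := by
    intro j
    have hle : n ≤ 2 ^ j * n := Nat.le_mul_of_pos_left _ (by positivity)
    have h3 := hn₁ (2 ^ j * n) (hn.trans hle)
    have h4 : ((j + Nat.log 2 n : ℕ) : ℝ) * Real.log 2 ≤ Real.log ((2 ^ j * n : ℕ) : ℝ) := by
      rw [← Real.log_pow]
      refine Real.log_le_log (by positivity) ?_
      have := Nat.pow_log_le_self 2 (show n ≠ 0 by omega)
      have : 2 ^ (j + Nat.log 2 n) ≤ 2 ^ j * n := by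
        rw [pow_add]; exact Nat.mul_le_mul_left _ this
      exact_mod_cast this
    have hpos : 0 < ((j + Nat.log 2 n : ℕ) : ℝ) := by
      have := Nat.log_pos (b := 2) (by norm_num) hn2
      exact_mod_cast (by omega : 0 < j + Nat.log 2 n)
    have h5 : unsatProb k (2 ^ j * n) a ≤
        |C| / (((j + Nat.log 2 n : ℕ) : ℝ) * Real.log 2) ^ (1 + ε) := by
      refine h3.trans ?_
      have hp : 0 < (((j + Nat.log 2 n : ℕ) : ℝ) * Real.log 2) ^ (1 + ε) := by positivity
      calc C / Real.log ((2 ^ j * n : ℕ) : ℝ) ^ (1 + ε)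
          ≤ |C| / Real.log ((2 ^ j * n : ℕ) : ℝ) ^ (1 + ε) := by
            have : 0 ≤ Real.log ((2 ^ j * n : ℕ) : ℝ) :=
              le_trans (by positivity) h4
            gcongr
            exact le_abs_self C
        _ ≤ _ := by gcongr
    have h6 : 2 * unsatProb k (2 ^ j * n) a ≤ D * g (j + Nat.log 2 n) := by
      refine (mul_le_mul_of_nonneg_left h5 (by norm_num)).trans_eq ?_
      rw [Real.mul_rpow hpos.le hl.le, hD, hg]
      field_simp
    rw [doublingError, hf]
    refine add_le_add (le_of_eq ?_) h6
    simp only [one_div, inv_pow]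
    field_simp
  calc ∑ j ∈ Finset.range J, doublingError k n a δ j
      ≤ ∑ j ∈ Finset.range J, (f j / n + D * g (j + Nat.log 2 n)) :=
        Finset.sum_le_sum fun j _ => hterm j
    _ = (∑ j ∈ Finset.range J, f j) / n + D * ∑ j ∈ Finset.range J, g (j + Nat.log 2 n) := by
        rw [Finset.sum_add_distrib, Finset.sum_div, Finset.mul_sum]
    _ ≤ (∑' j, f j) / n + D * ∑' j, g (j + Nat.log 2 n) := by
        gcongr
        · exact hfs.sum_le_tsum _ fun j _ => hf0 j
        · exact ((summable_nat_add_iff _).2 hgs).sum_le_tsum _ fun j _ => by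
            simp only [hg]; positivity
    _ ≤ η := by linarith

end Chain

section Binomial

variable {k n : ℕ} {a b φ : ℝ}

lemma wgt_neg_log {ι : Type*} [Fintype ι] {p : ℝ} (hp : p < 1) (F : Finset ι) :
    wgt (fun _ => -Real.log (1 - p)) F = p ^ F.card * (1 - p) ^ (Fintype.card ι - F.card) := by
  simp only [wgt, neg_neg, Real.exp_log (sub_pos.2 hp), sub_sub_cancel]
  rw [Finset.prod_ite, Finset.prod_const, Finset.prod_const]
  congr 2
  · simp
  · rw [← Finset.card_compl]
    congr 1
    ext
    simp

/-- The probability with which a clause is selected. -/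
def clauseProb (k n : ℕ) (a : ℝ) : ℝ := a * n / Fintype.card (Clause n k)

/-- The Poissonized intensity of a clause in the binomial model. -/
def hazard (k n : ℕ) (a : ℝ) : ℝ := -Real.log (1 - clauseProb k n a)

lemma clauseProb_nonneg (ha : 0 ≤ a) : 0 ≤ clauseProb k n a := by
  unfold clauseProb
  positivity

lemma clauseProb_mono (hab : a ≤ b) : clauseProb k n a ≤ clauseProb k n b := by
  unfold clauseProb
  gcongr

lemma Pn_eq_avg (hp : clauseProb k n a < 1) : Pn k n a φ =
    avg (fun _ : Clause n k => hazard k n a)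
      fun F => if (Z F : ℝ) < (2 : ℝ) ^ ((n : ℝ) * φ) then 1 else 0 := by
  unfold Pn avg
  refine Finset.sum_congr rfl fun F _ => ?_
  simp only [hazard, wgt_neg_log hp, mul_ite, mul_one, mul_zero]
  rfl

lemma clauseProb_le_hazard (hp : clauseProb k n a < 1) : clauseProb k n a ≤ hazard k n a := by
  have := Real.log_le_sub_one_of_pos (sub_pos.2 hp)
  unfold hazard
  linarith

lemma hazard_nonneg (ha : 0 ≤ a) (hp : clauseProb k n a < 1) : 0 ≤ hazard k n a :=
  (clauseProb_nonneg ha).trans (clauseProb_le_hazard hp)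

lemma hazard_mono (hab : a ≤ b) (hp : clauseProb k n b < 1) : hazard k n a ≤ hazard k n b := by
  have := clauseProb_mono (k := k) (n := n) hab
  unfold hazard
  gcongr

lemma tau_le_clauseProb (hk : 1 ≤ k) (hn : k ≤ n) (ha : 0 ≤ a) :
    tau k n a ≤ clauseProb k n a := by
  have hn0 : 0 < n := by omega
  have hch : (0 : ℝ) < n.choose k := by exact_mod_cast Nat.choose_pos hn
  have h1 : (k.factorial : ℝ) * n.choose k ≤ (n : ℝ) ^ k := by
    exact_mod_cast (Nat.descFactorial_eq_factorial_mul_choose n k) ▸ Nat.descFactorial_le_pow n k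
  have hn1 : (n : ℝ) ^ k = n ^ (k - 1) * n := by
    rw [← pow_succ, Nat.sub_add_cancel hk]
  unfold tau clauseProb
  rw [card_clause]
  push_cast
  rw [div_le_div_iff₀ (by positivity) (by positivity)]
  calc a * k.factorial * (n.choose k * 2 ^ k) = a * 2 ^ k * (k.factorial * n.choose k) := by ring
    _ ≤ a * 2 ^ k * (n : ℝ) ^ k := by gcongr
    _ = _ := by rw [hn1]; ring

lemma tendsto_clauseProb_div_tau (hk : 1 ≤ k) :
    Tendsto (fun n : ℕ => clauseProb k n 1 / tau k n 1) atTop (𝓝 1) := by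
  have h := (Asymptotics.isEquivalent_iff_tendsto_one (by
    filter_upwards [eventually_ge_atTop k] with n hn
    exact_mod_cast (Nat.choose_pos hn).ne')).1 (isEquivalent_choose k).symm
  refine h.congr' ?_
  filter_upwards [eventually_ge_atTop k] with n hn
  have hn0 : (n : ℝ) ≠ 0 := by
    have : n ≠ 0 := by omega
    exact_mod_cast this
  have hch : (n.choose k : ℝ) ≠ 0 := by exact_mod_cast (Nat.choose_pos hn).ne'
  have hfac : (k.factorial : ℝ) ≠ 0 := by positivity
  have hn1 : (n : ℝ) ^ k = n ^ (k - 1) * n := by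
    rw [← pow_succ, Nat.sub_add_cancel hk]
  simp only [Pi.div_apply, clauseProb, tau, card_clause, Nat.cast_mul, Nat.cast_pow,
    Nat.cast_ofNat, hn1]
  field_simp

lemma tendsto_tau (hk : 2 ≤ k) : Tendsto (fun n : ℕ => tau k n 1) atTop (𝓝 0) := by
  have hk1 : k - 1 ≠ 0 := by omega
  have h : Tendsto (fun n : ℕ => (k.factorial : ℝ) / 2 ^ k / (n : ℝ) ^ (k - 1)) atTop (𝓝 0) :=
    ((tendsto_pow_atTop hk1).comp
      tendsto_natCast_atTop_atTop).const_div_atTop _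
  refine h.congr fun n => ?_
  rw [tau, one_mul, div_div]

lemma tendsto_clauseProb (hk : 2 ≤ k) (a : ℝ) :
    Tendsto (fun n : ℕ => clauseProb k n a) atTop (𝓝 0) := by
  have h := (((tendsto_clauseProb_div_tau (one_le_two.trans hk)).mul (tendsto_tau hk)).const_mul a)
  simp only [mul_zero] at h
  refine h.congr' ?_
  filter_upwards [eventually_ge_atTop 1] with n hn
  have : tau k n 1 ≠ 0 := by
    unfold tau
    positivity
  rw [div_mul_cancel₀ _ this, clauseProb, clauseProb]
  ring

lemma eventually_clauseProb_lt_one (hk : 2 ≤ k) (a : ℝ) :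
    ∀ᶠ n : ℕ in atTop, clauseProb k n a < 1 :=
  (tendsto_clauseProb hk a).eventually_lt_const one_pos

lemma eventually_tau_le_hazard (hk : 2 ≤ k) (ha : 0 ≤ a) :
    ∀ᶠ n : ℕ in atTop, tau k n a ≤ hazard k n a := by
  filter_upwards [eventually_clauseProb_lt_one hk a, eventually_ge_atTop k] with n hp hn
  exact (tau_le_clauseProb (by omega) hn ha).trans (clauseProb_le_hazard hp)

lemma eventually_hazard_le_tau (hk : 2 ≤ k) (hab : a < b) :
    ∀ᶠ n : ℕ in atTop, hazard k n a ≤ tau k n b := by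
  have h1 : Tendsto (fun n : ℕ => a * (clauseProb k n 1 / tau k n 1) / (1 - clauseProb k n a))
      atTop (𝓝 a) := by
    have := ((tendsto_clauseProb_div_tau (k := k) (by omega)).const_mul a).div
      ((tendsto_clauseProb hk a).const_sub 1) (by norm_num)
    simpa [Pi.div_def] using this
  filter_upwards [h1.eventually_lt_const hab, eventually_clauseProb_lt_one hk a,
    eventually_ge_atTop 1] with n h hp hn
  have hp' := sub_pos.2 hp
  have hτ : 0 < tau k n 1 := by
    unfold tau
    positivity
  have h2 := Real.one_sub_inv_le_log_of_pos hp'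
  have h3 : hazard k n a ≤ clauseProb k n a / (1 - clauseProb k n a) := by
    have : (1 - clauseProb k n a)⁻¹ - 1 = clauseProb k n a / (1 - clauseProb k n a) := by
      field_simp
      ring
    unfold hazard
    linarith
  have h4 : clauseProb k n a = a * clauseProb k n 1 := by
    unfold clauseProb
    ring
  have h5 : tau k n b = b * tau k n 1 := by
    unfold tau
    ring
  refine h3.trans ?_
  rw [div_lt_iff₀ hp', ← mul_div_assoc, div_lt_iff₀ hτ] at h
  rw [div_le_iff₀ hp', h5]
  nlinarith

lemma monotone_indicator_Z_lt (t : ℝ) :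
    Monotone fun F : Finset (Clause n k) => if (Z F : ℝ) < t then (1 : ℝ) else 0 := by
  intro F G hFG
  have : (Z G : ℝ) ≤ Z F := by exact_mod_cast Z_antitone hFG
  dsimp only
  split_ifs <;> linarith

lemma Pn_nonneg (ha : 0 ≤ a) (hp : clauseProb k n a < 1) : 0 ≤ Pn k n a φ := by
  rw [Pn_eq_avg hp]
  have := avg_mono (fun _ : Clause n k => hazard_nonneg ha hp) (g := fun _ => 0)
    (h := fun F => if (Z F : ℝ) < (2 : ℝ) ^ ((n : ℝ) * φ) then 1 else 0)
    fun F => by split_ifs <;> norm_num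
  rwa [avg_const] at this

lemma Pn_le_one (ha : 0 ≤ a) (hp : clauseProb k n a < 1) : Pn k n a φ ≤ 1 := by
  rw [Pn_eq_avg hp]
  have := avg_mono (fun _ : Clause n k => hazard_nonneg ha hp) (h := fun _ => 1)
    (g := fun F => if (Z F : ℝ) < (2 : ℝ) ^ ((n : ℝ) * φ) then 1 else 0)
    fun F => by split_ifs <;> norm_num
  rwa [avg_const] at this

lemma Pn_mono_right {ψ : ℝ} (ha : 0 ≤ a) (hp : clauseProb k n a < 1) (h : φ ≤ ψ) :
    Pn k n a φ ≤ Pn k n a ψ := by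
  rw [Pn_eq_avg hp, Pn_eq_avg hp]
  refine avg_mono (fun _ => hazard_nonneg ha hp) fun F => ?_
  have : (2 : ℝ) ^ ((n : ℝ) * φ) ≤ (2 : ℝ) ^ ((n : ℝ) * ψ) :=
    Real.rpow_le_rpow_of_exponent_le one_le_two (by gcongr)
  split_ifs <;> linarith

lemma Pn_mono_left (ha : 0 ≤ a) (hab : a ≤ b) (hp : clauseProb k n b < 1) :
    Pn k n a φ ≤ Pn k n b φ := by
  have hpa := (clauseProb_mono hab).trans_lt hp
  rw [Pn_eq_avg hpa, Pn_eq_avg hp]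
  exact avg_le_of_monotone (fun _ => hazard_nonneg ha hpa) (fun _ => hazard_mono hab hp)
    (monotone_indicator_Z_lt _)

lemma unsatProb_le_Pn (ha : 0 ≤ a) (hp : clauseProb k n a < 1) (h : tau k n a ≤ hazard k n a) :
    unsatProb k n a ≤ Pn k n a 0 := by
  rw [Pn_eq_avg hp]
  refine (avg_mono (fun _ => tau_nonneg ha) fun F => le_of_eq ?_).trans
    (avg_le_of_monotone (fun _ => tau_nonneg ha) (fun _ => h) (monotone_indicator_Z_lt _))
  simp

/-- The set of densities whose supremum is `alphaStar`. -/
def IsGood (k : ℕ) (a : ℝ) : Prop :=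
  ∃ ε : ℝ, 0 < ε ∧ ∃ C : ℝ, ∀ᶠ n : ℕ in atTop, Pn k n a 0 ≤ C / Real.log n ^ (1 + ε)

lemma exists_isGood_of_lt_alphaStar (ha : 0 ≤ a) (h : a < alphaStar k) :
    ∃ b, a < b ∧ IsGood k b := by
  have hne : {x | IsGood k x}.Nonempty := by
    by_contra hne
    rw [Set.not_nonempty_iff_eq_empty] at hne
    have : alphaStar k = 0 := by
      change sSup {x | IsGood k x} = 0
      rw [hne, Real.sSup_empty]
    linarith
  obtain ⟨b, hb, hab⟩ := exists_lt_of_lt_csSup hne h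
  exact ⟨b, hab, hb⟩

lemma IsGood.exists_unsatProb_le (hk : 2 ≤ k) (hb : IsGood k b) (ha : 0 ≤ a) (hab : a ≤ b) :
    ∃ ε : ℝ, 0 < ε ∧ ∃ C : ℝ, ∀ᶠ n : ℕ in atTop, unsatProb k n a ≤ C / Real.log n ^ (1 + ε) := by
  obtain ⟨ε, hε, C, h⟩ := hb
  refine ⟨ε, hε, C, ?_⟩
  filter_upwards [h, eventually_clauseProb_lt_one hk b,
    eventually_tau_le_hazard hk (ha.trans hab)] with n h hp hτ
  exact ((unsatProb_mono ha hab).trans (unsatProb_le_Pn (ha.trans hab) hp hτ)).trans h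

lemma tendsto_const_div_log_rpow (C : ℝ) {ε : ℝ} (hε : 0 < ε) :
    Tendsto (fun n : ℕ => C / Real.log n ^ (1 + ε)) atTop (𝓝 0) :=
  ((tendsto_rpow_atTop (by linarith)).comp
    (Real.tendsto_log_atTop.comp tendsto_natCast_atTop_atTop)).const_div_atTop C

lemma IsGood.tendsto_Pn_zero (hk : 2 ≤ k) (hb : IsGood k b) (ha : 0 ≤ a) (hab : a ≤ b) :
    Tendsto (fun n : ℕ => Pn k n a 0) atTop (𝓝 0) := by
  obtain ⟨ε, hε, C, h⟩ := hb
  refine squeeze_zero' ?_ ?_ (tendsto_const_div_log_rpow C hε)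
  · filter_upwards [eventually_clauseProb_lt_one hk a] with n hp using Pn_nonneg ha hp
  · filter_upwards [h, eventually_clauseProb_lt_one hk b] with n h hp
    exact (Pn_mono_left ha hab hp).trans h

end Binomial

section LowerTail

variable {k n : ℕ} {a b φ ψ : ℝ}

/-- Markov's inequality for `W ^ (-r)`. -/
lemma avg_Z_lt_le (hn : 1 ≤ n) (ha : 0 ≤ a) {r : ℝ} (hr : 0 < r) (hψ : 0 ≤ ψ) :
    avg (fun _ : Clause n k => tau k n a)
        (fun F => if (Z F : ℝ) < (2 : ℝ) ^ ((n : ℝ) * ψ) then 1 else 0) ≤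
      Real.exp (r * n * (ψ * Real.log 2 - rate k n a r) + r * Real.log 2) := by
  have hpoint : ∀ F : Finset (Clause n k),
      (if (Z F : ℝ) < (2 : ℝ) ^ ((n : ℝ) * ψ) then 1 else 0) ≤
        ((2 : ℝ) ^ ((n : ℝ) * ψ + 1)) ^ r * W F ^ (-r) := by
    intro F
    split_ifs with h
    · have h1 : (1 : ℝ) ≤ (2 : ℝ) ^ ((n : ℝ) * ψ) :=
        Real.one_le_rpow one_le_two (by positivity)
      have h2 : W F ≤ (2 : ℝ) ^ ((n : ℝ) * ψ + 1) := by
        rw [Real.rpow_add_one two_ne_zero, W]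
        linarith
      have h3 := Real.rpow_le_rpow (W_pos F).le h2 hr.le
      rw [Real.rpow_neg (W_pos F).le, ← div_eq_mul_inv, one_le_div (Real.rpow_pos_of_pos (W_pos F) r)]
      exact h3
    · have := Real.rpow_pos_of_pos (W_pos F) (-r)
      positivity
  refine (avg_mono (fun _ => tau_nonneg ha) hpoint).trans (le_of_eq ?_)
  rw [avg_const_mul]
  change _ * negMoment k n a r = _
  have hpos := negMoment_pos (k := k) (n := n) ha hr.le
  have hn0 : (n : ℝ) ≠ 0 := by positivity
  have hlog : Real.log (negMoment k n a r) = -(r * n * rate k n a r) := by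
    unfold rate
    field_simp
  conv_lhs => rw [← Real.exp_log hpos, hlog]
  rw [← Real.rpow_mul zero_le_two, Real.rpow_def_of_pos two_pos, ← Real.exp_add]
  congr 1
  ring

/-- Passing from `n` to `n + s` variables. -/
lemma Pn_le_avg_Z_lt (s : ℕ) (hb : 0 ≤ b) (hp : clauseProb k n b < 1)
    (hτ : hazard k n b ≤ tau k (n + s) a) (hψ : (n : ℝ) * ψ + s ≤ ((n + s : ℕ) : ℝ) * φ) :
    Pn k n b ψ ≤ avg (fun _ : Clause (n + s) k => tau k (n + s) a)
      (fun F => if (Z F : ℝ) < (2 : ℝ) ^ (((n + s : ℕ) : ℝ) * φ) then 1 else 0) := by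
  have h0 := hazard_nonneg hb hp
  rw [Pn_eq_avg hp]
  set e : Clause n k ↪ Clause (n + s) k := clauseMap (Fin.castAddEmb s) with he
  set h : Finset (Clause (n + s) k) → ℝ :=
    fun F => if (Z F : ℝ) < (2 : ℝ) ^ (((n + s : ℕ) : ℝ) * φ) then 1 else 0 with hh
  set lam : Clause (n + s) k → ℝ := fun c => if c ∈ Set.range e then hazard k n b else 0 with hlam
  have h1 : avg lam h ≤ avg (fun _ => tau k (n + s) a) h := by
    refine avg_le_of_monotone (fun c => ?_) (fun c => ?_) (monotone_indicator_Z_lt _)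
    · simp only [hlam]
      split_ifs <;> linarith
    · simp only [hlam]
      split_ifs <;> linarith
  refine le_trans ?_ h1
  rw [avg_eq_avg_map e (fun c hc => by simp only [hlam, if_neg hc])]
  have h2 : (fun d => lam (e d)) = fun _ => hazard k n b := by
    funext d
    simp [hlam]
  rw [h2]
  refine avg_mono (fun _ => h0) fun G => ?_
  by_cases hG : (Z G : ℝ) < (2 : ℝ) ^ ((n : ℝ) * ψ)
  · have h3 : (Z (G.map e) : ℝ) < (2 : ℝ) ^ (((n + s : ℕ) : ℝ) * φ) := by
      calc (Z (G.map e) : ℝ) ≤ Z G * 2 ^ s := by exact_mod_cast Z_castAdd_le s G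
        _ < (2 : ℝ) ^ ((n : ℝ) * ψ) * 2 ^ s := by gcongr
        _ = (2 : ℝ) ^ ((n : ℝ) * ψ + s) := by
          rw [Real.rpow_add two_pos, Real.rpow_natCast]
        _ ≤ _ := Real.rpow_le_rpow_of_exponent_le one_le_two hψ
    simp only [hh, if_pos hG, if_pos h3, le_refl]
  · simp only [if_neg hG, hh]
    split_ifs <;> norm_num

lemma mergeConst_mono {m m' : ℕ} (h : m ≤ m') {δ : ℝ} (hδ : 0 < δ) :
    mergeConst k m δ ≤ mergeConst k m' δ := by
  unfold mergeConst
  gcongr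

/-- Writing a large number as a multiple of a doubling of `n`, up to a small remainder. -/
lemma exists_doubling_multiple {M N : ℕ} (hn : 1 ≤ n) (hM : 1 ≤ M) (hN : n * M ≤ N) :
    ∃ j m s : ℕ, N + s = m * (2 ^ j * n) ∧ 1 ≤ m ∧ m ≤ 2 * M ∧ s * M ≤ N ∧
      N < 2 * M * (2 ^ j * n) := by
  have hnM : 0 < n * M := by positivity
  set q := N / (n * M) with hq
  have hq0 : q ≠ 0 := (Nat.div_pos hN hnM).ne'
  have h1 : 2 ^ Nat.log 2 q ≤ q := Nat.pow_log_le_self 2 hq0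
  have h2 : q < 2 ^ (Nat.log 2 q + 1) := Nat.lt_pow_succ_log_self one_lt_two q
  set j := Nat.log 2 q
  set L := 2 ^ j * n with hL
  have hL0 : 0 < L := by positivity
  have hq1 : q * (n * M) ≤ N := Nat.div_mul_le_self _ _
  have hq2 : N < (q + 1) * (n * M) := by
    rw [mul_comm]
    exact Nat.lt_mul_div_succ N hnM
  have hLM : L * M ≤ N := by
    calc L * M = 2 ^ j * (n * M) := by rw [hL]; ring
      _ ≤ q * (n * M) := Nat.mul_le_mul_right _ h1
      _ ≤ N := hq1
  have hNL : N < 2 * M * L := by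
    calc N < (q + 1) * (n * M) := hq2
      _ ≤ 2 ^ (j + 1) * (n * M) := Nat.mul_le_mul_right _ h2
      _ = 2 * M * L := by rw [hL]; ring
  have h3 : N < (N / L + 1) * L := by
    rw [mul_comm]
    exact Nat.lt_mul_div_succ N hL0
  have h4 : (N / L + 1) * L ≤ N + L := by
    rw [add_mul, one_mul]
    exact Nat.add_le_add_right (Nat.div_mul_le_self _ _) _
  refine ⟨j, N / L + 1, (N / L + 1) * L - N, Nat.add_sub_cancel' h3.le, Nat.succ_pos _, ?_, ?_, hNL⟩
  · exact Nat.succ_le_of_lt ((Nat.div_lt_iff_lt_mul hL0).2 hNL)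
  · calc ((N / L + 1) * L - N) * M ≤ L * M := Nat.mul_le_mul_right _ (by omega)
      _ ≤ N := hLM

lemma merge_error_mono {x x' u U m M L κ κ' : ℝ} (hx : 0 ≤ x) (hxx : x ≤ x') (hu : 0 ≤ u)
    (huU : u ≤ U) (hm : 0 ≤ m) (hmM : m ≤ M) (hL : 0 ≤ L) (hκ : 0 ≤ κ) (hκκ : κ ≤ κ') :
    (1 + x * κ) / L + m * u ≤ (1 + x' * κ') / L + M * U := by
  gcongr
  · exact hx.trans hxx
  · exact hm.trans hmM

lemma eventually_le_rate (hk : 2 ≤ k) (ha : 0 ≤ a) {δ ε C θ g : ℝ} {M : ℕ} (hδ0 : 0 < δ)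
    (hδ1 : δ ≤ 1) (hε : 0 < ε)
    (hU : ∀ᶠ n : ℕ in atTop, unsatProb k n a ≤ C / Real.log n ^ (1 + ε))
    (hφ : ∃ᶠ n : ℕ in atTop, φ ≤ meanEntropy k n a) (hM : 1 ≤ M) (hθ : 0 < θ) (hg : 0 < g) :
    ∀ᶠ N : ℕ in atTop, ∃ s : ℕ, s * M ≤ N ∧ Real.log 2 * φ - g ≤
      rate k (N + s) (a * (1 - δ) * (1 - δ)) (θ / ((N + s : ℕ) : ℝ)) := by
  set K : ℝ := 6 * 64 ^ θ with hK
  have hK0 : 0 < K := by positivity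
  set η : ℝ := g / (3 * K) with hη
  have hη0 : 0 < η := by positivity
  have hKη : K * η = g / 3 := by
    rw [hη]
    field_simp
  have hlim : Tendsto (fun L : ℕ => (1 + a * mergeConst k (2 * M) δ) / (L : ℝ) +
      (2 * M : ℕ) * (C / Real.log L ^ (1 + ε))) atTop (𝓝 0) := by
    have := (tendsto_natCast_atTop_atTop.const_div_atTop (1 + a * mergeConst k (2 * M) δ)).add
      ((tendsto_const_div_log_rpow C hε).const_mul ((2 * M : ℕ) : ℝ))
    simpa using this
  obtain ⟨L₀, hL₀⟩ := eventually_atTop.1 ((hlim.eventually_le_const hη0).and hU)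
  obtain ⟨n, hnφ, hnη, hn⟩ := (hφ.and_eventually
    ((eventually_sum_doublingError_le ha hδ0 hε hU hη0).and (eventually_ge_atTop 1))).exists
  obtain ⟨N₁, hN₁⟩ := exists_nat_ge (4 * θ * n / (g / 3))
  filter_upwards [eventually_ge_atTop (n * M), eventually_ge_atTop (2 * M * L₀),
    eventually_ge_atTop N₁, eventually_ge_atTop 1] with N hNM hNL hNN hN1
  obtain ⟨j, m, s, hNs, hm1, hmM, hsM, hNlt⟩ := exists_doubling_multiple hn hM hNM
  refine ⟨s, hsM, ?_⟩
  have hL1 : 1 ≤ 2 ^ j * n := Nat.mul_pos (by positivity) hn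
  have hdoub := fun r => rate_doubling (r := r) (θ := θ) hk hn ha hδ0 hδ1
  replace hdoub := fun r hr => hdoub r hr j
  have hLcast : (2 : ℝ) ^ j * n = ((2 ^ j * n : ℕ) : ℝ) := by push_cast; ring
  rw [hLcast] at hdoub
  generalize 2 ^ j * n = L at *
  have hLL : L₀ ≤ L := by
    by_contra hlt
    have : 2 * M * L ≤ 2 * M * L₀ := Nat.mul_le_mul_left _ (by omega)
    omega
  have hNs' : (m : ℝ) * L = ((N + s : ℕ) : ℝ) := by
    rw [hNs]
    push_cast
    ring
  have hpos : (0 : ℝ) < ((N + s : ℕ) : ℝ) := by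
    have : 0 < N + s := by omega
    exact_mod_cast this
  set r := θ / ((N + s : ℕ) : ℝ) with hr
  have hr0 : 0 < r := by positivity
  have hrθ : r * ((N + s : ℕ) : ℝ) = θ := by
    rw [hr]
    field_simp
  have ha1 : 0 ≤ a * (1 - δ) := mul_nonneg ha (by linarith)
  obtain ⟨hE, hUL⟩ := hL₀ L hLL
  have hmerge := rate_merge hk hm1 hL1 ha1 hδ0 hδ1 hr0 (by rw [hNs', hrθ] : r * (m * L) ≤ θ)
  have hdoub := hdoub r hr0 (by
    rw [← hrθ, ← hNs']
    have h2 : (1 : ℝ) ≤ m := by exact_mod_cast hm1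
    have h3 : (0 : ℝ) ≤ L := by positivity
    have h4 : (L : ℝ) ≤ m * L := by nlinarith
    gcongr)
  have hdd := doublingDensity_mem ha hδ0.le hδ1 j
  have hanti : rate k L (doublingDensity a δ j) r ≤ rate k L (a * (1 - δ)) r := by
    refine rate_antitone ha1 (le_trans ?_ hdd.1) hr0.le
    have : 0 ≤ δ / ((j : ℝ) + 1) := by positivity
    gcongr
    linarith
  have hbase := meanEntropy_le_rate (k := k) hn ha hr0
  have hbase2 : 4 * r * n ≤ g / 3 := by
    have h1 : (N₁ : ℝ) ≤ ((N + s : ℕ) : ℝ) := by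
      have : N₁ ≤ N + s := by omega
      exact_mod_cast this
    have h2 := hN₁.trans h1
    rw [div_le_iff₀ (by positivity)] at h2
    have h3 : 4 * r * n = 4 * θ * n / ((N + s : ℕ) : ℝ) := by
      rw [hr]
      ring
    rw [h3, div_le_iff₀ hpos]
    linarith
  have hsum : K * ∑ i ∈ Finset.range j, doublingError k n a δ i ≤ g / 3 := by
    rw [← hKη]
    exact mul_le_mul_of_nonneg_left (hnη j) hK0.le
  have herr : K * ((1 + a * (1 - δ) * mergeConst k m δ) / L + m * unsatProb k L (a * (1 - δ))) ≤
      g / 3 := by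
    rw [← hKη]
    refine mul_le_mul_of_nonneg_left (le_trans ?_ hE) hK0.le
    have h1 : a * (1 - δ) ≤ a := by nlinarith
    have h2 := mergeConst_mono (k := k) hmM hδ0
    have h3 := mergeConst_nonneg k m hδ0.le
    have h4 : (m : ℝ) ≤ ((2 * M : ℕ) : ℝ) := by exact_mod_cast hmM
    have h5 := (unsatProb_mono (k := k) (n := L) ha1 h1).trans hUL
    have h6 := unsatProb_nonneg (k := k) (n := L) ha1
    exact merge_error_mono ha1 h1 h6 h5 (Nat.cast_nonneg m) h4 (Nat.cast_nonneg L) h3 h2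
  have hlogφ : Real.log 2 * φ ≤ Real.log 2 * meanEntropy k n a :=
    mul_le_mul_of_nonneg_left hnφ (Real.log_nonneg one_le_two)
  rw [hNs]
  linarith

lemma tendsto_Pn_of_frequently (hk : 2 ≤ k) (hb : 0 ≤ b) (hba : b < a) {ε C : ℝ} (hε : 0 < ε)
    (hU : ∀ᶠ n : ℕ in atTop, unsatProb k n a ≤ C / Real.log n ^ (1 + ε))
    (hφ : ∃ᶠ n : ℕ in atTop, φ ≤ meanEntropy k n a) (hψ0 : 0 ≤ ψ) (hψ : ψ < φ) :
    Tendsto (fun n : ℕ => Pn k n b ψ) atTop (𝓝 0) := by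
  have ha : 0 < a := hb.trans_lt hba
  set δ := (a - b) / (4 * a) with hδ
  have hδ0 : 0 < δ := by
    have := sub_pos.2 hba
    positivity
  have hδ1 : δ ≤ 1 := by
    rw [hδ, div_le_one (by positivity)]
    linarith
  have haδ : a * δ = (a - b) / 4 := by
    rw [hδ]
    field_simp
  have hfin : (a + b) / 2 ≤ a * (1 - δ) * (1 - δ) := by
    nlinarith [mul_nonneg ha.le (sq_nonneg δ)]
  set b' := (a + 3 * b) / 4 with hb'
  have hone : Tendsto (fun M : ℕ => 1 / (M : ℝ)) atTop (𝓝 0) :=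
    tendsto_natCast_atTop_atTop.const_div_atTop 1
  have hMlim : Tendsto (fun M : ℕ => b' * (1 + 1 / (M : ℝ)) ^ (k - 1)) atTop (𝓝 b') := by
    have := ((hone.const_add 1).pow (k - 1)).const_mul b'
    simpa using this
  obtain ⟨M, hM1, hM2, hM⟩ := ((hMlim.eventually_le_const (by linarith : b' < (a + b) / 2)).and
    ((hone.eventually_lt_const (sub_pos.2 hψ)).and (eventually_ge_atTop 1))).exists
  have hM0 : (0 : ℝ) < M := by exact_mod_cast hM
  set ψ' := ψ + 1 / (M : ℝ) with hψ'
  set g := Real.log 2 * (φ - ψ') / 2 with hgdef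
  have hg : 0 < g := by
    have h1 := Real.log_pos one_lt_two
    have h2 : 0 < φ - ψ' := by linarith
    positivity
  have key : ∀ ζ : ℝ, 0 < ζ → ∀ᶠ N : ℕ in atTop, Pn k N b ψ ≤ ζ := by
    intro ζ hζ
    set θ := (1 + |Real.log ζ|) / g with hθdef
    have hθ : 0 < θ := by positivity
    have hθg : θ * g = 1 + |Real.log ζ| := by
      rw [hθdef]
      field_simp
    obtain ⟨N₁, hN₁⟩ := exists_nat_ge θ
    filter_upwards [eventually_le_rate hk ha.le hδ0 hδ1 hε hU hφ hM hθ hg,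
      eventually_clauseProb_lt_one hk b, eventually_hazard_le_tau hk (by linarith : b < b'),
      eventually_ge_atTop N₁, eventually_ge_atTop 1] with N hN hp hhaz hNN hN1
    obtain ⟨s, hsM, hrate⟩ := hN
    have hN0 : (0 : ℝ) < N := by exact_mod_cast hN1
    have hs : (s : ℝ) ≤ N / M := by
      rw [le_div_iff₀ hM0]
      exact_mod_cast hsM
    have hτ : tau k N b' ≤ tau k (N + s) (a * (1 - δ) * (1 - δ)) := by
      unfold tau
      rw [div_le_div_iff₀ (by positivity) (by positivity)]
      have h1 : ((N + s : ℕ) : ℝ) ≤ N * (1 + 1 / M) := by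
        push_cast
        have : (N : ℝ) * (1 + 1 / M) = N + N / M := by ring
        linarith
      have h2 : ((N + s : ℕ) : ℝ) ^ (k - 1) ≤ (N : ℝ) ^ (k - 1) * (1 + 1 / M) ^ (k - 1) := by
        rw [← mul_pow]
        gcongr
      have hb'0 : 0 ≤ b' := by linarith
      calc b' * k.factorial * (2 ^ k * ((N + s : ℕ) : ℝ) ^ (k - 1))
          ≤ b' * k.factorial * (2 ^ k * ((N : ℝ) ^ (k - 1) * (1 + 1 / M) ^ (k - 1))) := by gcongr
        _ = (b' * (1 + 1 / M) ^ (k - 1)) * (k.factorial * (2 ^ k * (N : ℝ) ^ (k - 1))) := by ring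
        _ ≤ (a * (1 - δ) * (1 - δ)) * (k.factorial * (2 ^ k * (N : ℝ) ^ (k - 1))) := by
          exact mul_le_mul_of_nonneg_right (hM1.trans hfin) (by positivity)
        _ = _ := by ring
    have hψs : (N : ℝ) * ψ + s ≤ ((N + s : ℕ) : ℝ) * ψ' := by
      have h1 : (N : ℝ) * ψ' = N * ψ + N / M := by
        rw [hψ']
        ring
      have h2 : 0 ≤ (s : ℝ) * ψ' := by positivity
      push_cast
      linarith
    have hpos : (0 : ℝ) < ((N + s : ℕ) : ℝ) := by
      push_cast
      positivity
    have h3 := (Pn_le_avg_Z_lt s hb hp (hhaz.trans hτ) hψs).trans (avg_Z_lt_le (by omega)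
      (by linarith) (div_pos hθ hpos) (by positivity))
    refine h3.trans ?_
    rw [div_mul_cancel₀ _ hpos.ne']
    rw [← Real.le_log_iff_exp_le hζ]
    have h4 : θ / ((N + s : ℕ) : ℝ) ≤ 1 := by
      rw [div_le_one hpos]
      refine hN₁.trans ?_
      have : N₁ ≤ N + s := by omega
      exact_mod_cast this
    have h5 : Real.log 2 ≤ 1 := by linarith [Real.log_two_lt_d9]
    have h6 : θ / ((N + s : ℕ) : ℝ) * Real.log 2 ≤ 1 :=
      mul_le_one₀ h4 (Real.log_nonneg one_le_two) h5
    have h7 : ψ' * Real.log 2 - rate k (N + s) (a * (1 - δ) * (1 - δ)) (θ / ((N + s : ℕ) : ℝ)) ≤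
        -g := by
      have : 2 * g = Real.log 2 * φ - ψ' * Real.log 2 := by
        rw [hgdef]
        ring
      linarith
    have h8 := mul_le_mul_of_nonneg_left h7 hθ.le
    have h9 := neg_abs_le (Real.log ζ)
    linarith
  refine Metric.tendsto_nhds.2 fun ζ hζ => ?_
  filter_upwards [key (ζ / 2) (half_pos hζ), eventually_clauseProb_lt_one hk b] with N hN hp
  rw [Real.dist_eq, sub_zero, abs_of_nonneg (Pn_nonneg hb hp)]
  linarith

end LowerTail

section Concentration

variable {k n : ℕ} {a b φ ε : ℝ}

lemma meanEntropy_nonneg (ha : 0 ≤ a) : 0 ≤ meanEntropy k n a := by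
  have := avg_mono (fun _ : Clause n k => tau_nonneg (k := k) (n := n) ha) (g := fun _ => 0)
    entropy_nonneg
  rw [avg_const] at this
  unfold meanEntropy
  positivity

lemma meanEntropy_le_one (ha : 0 ≤ a) : meanEntropy k n a ≤ 1 := by
  have := avg_mono (fun _ : Clause n k => tau_nonneg (k := k) (n := n) ha) (h := fun _ => (n : ℝ))
    entropy_le
  rw [avg_const] at this
  exact div_le_one_of_le₀ this (Nat.cast_nonneg n)

lemma meanEntropy_antitone (ha : 0 ≤ a) (hab : a ≤ b) : meanEntropy k n b ≤ meanEntropy k n a := by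
  have := avg_le_of_antitone (fun _ : Clause n k => tau_nonneg (k := k) (n := n) ha)
    (fun _ => tau_mono hab) entropy_antitone
  unfold meanEntropy
  gcongr

/-- The limiting entropy density, extended to negative densities by its value at zero. -/
def limitEntropy (k : ℕ) (a : ℝ) : ℝ := limsup (fun n : ℕ => meanEntropy k n (max a 0)) atTop

lemma isBoundedUnder_meanEntropy (ha : 0 ≤ a) :
    IsBoundedUnder (· ≤ ·) atTop fun n : ℕ => meanEntropy k n a :=
  isBoundedUnder_of ⟨1, fun _ => meanEntropy_le_one ha⟩

lemma isCoboundedUnder_meanEntropy (ha : 0 ≤ a) :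
    IsCoboundedUnder (· ≤ ·) atTop fun n : ℕ => meanEntropy k n a :=
  IsBoundedUnder.isCoboundedUnder_le (isBoundedUnder_of ⟨0, fun _ => meanEntropy_nonneg ha⟩)

lemma limitEntropy_antitone : Antitone (limitEntropy k) := fun a b hab => by
  have hm : max a 0 ≤ max b 0 := max_le_max_right 0 hab
  exact limsup_le_limsup
    (Eventually.of_forall fun n => meanEntropy_antitone (le_max_right a 0) hm)
    (isCoboundedUnder_meanEntropy (le_max_right b 0))
    (isBoundedUnder_meanEntropy (le_max_right a 0))

lemma limitEntropy_mem (k : ℕ) (a : ℝ) : limitEntropy k a ∈ Set.Icc (0 : ℝ) 1 := by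
  have ha := le_max_right a 0
  refine ⟨le_limsup_of_frequently_le (Frequently.of_forall fun n => meanEntropy_nonneg ha)
    (isBoundedUnder_meanEntropy ha), limsup_le_of_le (isCoboundedUnder_meanEntropy ha)
    (Eventually.of_forall fun n => meanEntropy_le_one ha)⟩

lemma tendsto_Pn_sub (hk : 2 ≤ k) (ha : 0 ≤ a) (has : a < alphaStar k)
    (hc : ContinuousAt (limitEntropy k) a) (hε : 0 < ε) :
    Tendsto (fun n : ℕ => Pn k n a (limitEntropy k a - ε)) atTop (𝓝 0) := by
  obtain ⟨b, hab, hb⟩ := exists_isGood_of_lt_alphaStar ha has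
  rcases lt_or_ge (limitEntropy k a - ε) 0 with hneg | hnn
  · refine squeeze_zero' ?_ ?_ (hb.tendsto_Pn_zero hk ha hab.le)
    · filter_upwards [eventually_clauseProb_lt_one hk a] with n hp using Pn_nonneg ha hp
    · filter_upwards [eventually_clauseProb_lt_one hk a] with n hp
      exact Pn_mono_right ha hp hneg.le
  · have h1 : ∀ᶠ x in 𝓝[>] a, limitEntropy k a - ε / 2 < limitEntropy k x :=
      (hc.eventually_const_lt (by linarith)).filter_mono nhdsWithin_le_nhds
    obtain ⟨x, hx, hax, hxb⟩ := (h1.and (Ioo_mem_nhdsGT hab)).exists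
    have hx0 : 0 ≤ x := ha.trans hax.le
    obtain ⟨ε', hε', C, hU⟩ := hb.exists_unsatProb_le hk hx0 hxb.le
    have hlim : limitEntropy k x = limsup (fun n : ℕ => meanEntropy k n x) atTop := by
      rw [limitEntropy, max_eq_left hx0]
    rw [hlim] at hx
    have hfreq := frequently_lt_of_lt_limsup (isCoboundedUnder_meanEntropy hx0) hx
    exact tendsto_Pn_of_frequently hk ha hax hε' hU (hfreq.mono fun n hn => hn.le) hnn (by linarith)

lemma le_entropy {t : ℝ} {F : Finset (Clause n k)} (h : (2 : ℝ) ^ ((n : ℝ) * t) ≤ Z F) :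
    n * t ≤ entropy F := by
  have h1 : (2 : ℝ) ^ ((n : ℝ) * t) ≤ max (Z F : ℝ) 1 := h.trans (le_max_left _ _)
  unfold entropy
  rwa [Real.le_logb_iff_rpow_le one_lt_two (by positivity)]

lemma Pn_add_ge {η : ℝ} (ha : 0 ≤ a) (hn : 1 ≤ n) (hp : clauseProb k n a < 1)
    (hτ : tau k n a ≤ hazard k n a) (hφ : φ ≤ 1) (hε : 0 < ε) (hη : 0 ≤ η)
    (hm : meanEntropy k n a ≤ φ + η) :
    ε * (1 - Pn k n a (φ + ε)) ≤ 2 * η + Pn k n a (φ - η) := by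
  have hn0 : (0 : ℝ) < n := by exact_mod_cast hn
  set lam : Clause n k → ℝ := fun _ => hazard k n a
  set u : Finset (Clause n k) → ℝ :=
    fun F => if (Z F : ℝ) < (2 : ℝ) ^ ((n : ℝ) * (φ - η)) then 1 else 0 with hu
  set v : Finset (Clause n k) → ℝ :=
    fun F => if (Z F : ℝ) < (2 : ℝ) ^ ((n : ℝ) * (φ + ε)) then 1 else 0 with hv
  have hpoint : ∀ F, (n * (φ - η + ε)) - (n * u F + n * ε * v F) ≤ entropy F := by
    intro F
    have hmono : (2 : ℝ) ^ ((n : ℝ) * (φ - η)) ≤ (2 : ℝ) ^ ((n : ℝ) * (φ + ε)) :=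
      Real.rpow_le_rpow_of_exponent_le one_le_two (by gcongr; linarith)
    by_cases h1 : (Z F : ℝ) < (2 : ℝ) ^ ((n : ℝ) * (φ - η))
    · simp only [hu, hv, if_pos h1, if_pos (h1.trans_le hmono)]
      have := entropy_nonneg F
      nlinarith
    · by_cases h2 : (Z F : ℝ) < (2 : ℝ) ^ ((n : ℝ) * (φ + ε))
      · simp only [hu, hv, if_neg h1, if_pos h2]
        have := le_entropy (not_lt.1 h1)
        linarith
      · simp only [hu, hv, if_neg h1, if_neg h2]
        have := le_entropy (not_lt.1 h2)
        nlinarith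
  have h1 := avg_mono (fun _ : Clause n k => hazard_nonneg ha hp) hpoint
  have h2 : avg (fun _ : Clause n k => hazard k n a) entropy ≤ n * (φ + η) := by
    refine (avg_le_of_antitone (fun _ => tau_nonneg ha) (fun _ => hτ) entropy_antitone).trans ?_
    rw [meanEntropy, div_le_iff₀ hn0] at hm
    linarith
  rw [avg_sub, avg_const, avg_add, avg_const_mul, avg_const_mul] at h1
  rw [Pn_eq_avg hp, Pn_eq_avg hp]
  change ε * (1 - avg lam v) ≤ 2 * η + avg lam u
  have h3 := h1.trans h2
  refine le_of_mul_le_mul_left ?_ hn0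
  linarith

lemma tendsto_Pn_add (hk : 2 ≤ k) (ha : 0 ≤ a) (has : a < alphaStar k)
    (hc : ContinuousAt (limitEntropy k) a) (hε : 0 < ε) :
    Tendsto (fun n : ℕ => Pn k n a (limitEntropy k a + ε)) atTop (𝓝 1) := by
  refine Metric.tendsto_nhds.2 fun ζ hζ => ?_
  have hη : 0 < ζ * ε / 4 := by positivity
  have hmean : ∀ᶠ n : ℕ in atTop, meanEntropy k n a < limitEntropy k a + ζ * ε / 4 := by
    refine eventually_lt_of_limsup_lt ?_ (isBoundedUnder_meanEntropy ha)
    rw [limitEntropy, max_eq_left ha]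
    linarith
  filter_upwards [hmean, eventually_ge_atTop 1, eventually_clauseProb_lt_one hk a,
    eventually_tau_le_hazard hk ha,
    (tendsto_Pn_sub hk ha has hc hη).eventually_lt_const hη] with n hm hn hp hτ hlow
  have h1 := Pn_add_ge ha hn hp hτ (limitEntropy_mem k a).2 hε hη.le hm.le
  have h2 := Pn_le_one (φ := limitEntropy k a + ε) ha hp
  rw [Real.dist_eq, abs_sub_comm, abs_of_nonneg (by linarith)]
  refine lt_of_mul_lt_mul_left (lt_of_le_of_lt h1 ?_) hε.le
  linarith

end Concentration

/-- **Concentration of the number of solutions of random `k`-SAT formulas.**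
There are a countable exceptional set `𝒞 ⊆ [0, α*)` and a function `φ_s : [0,α*) → [0,1]`
such that for every non-exceptional `α ∈ [0, α*)` and every `ε > 0`,
`P_n(α, φ_s(α) - ε) → 0` and `P_n(α, φ_s(α) + ε) → 1` as `n → ∞`. -/
theorem kSAT_concentration (k : ℕ) (hk : 2 ≤ k) :
    ∃ 𝒞 : Set ℝ, 𝒞.Countable ∧ 𝒞 ⊆ Set.Ico 0 (alphaStar k) ∧
      ∃ φs : ℝ → ℝ, (∀ α ∈ Set.Ico (0 : ℝ) (alphaStar k), φs α ∈ Set.Icc (0 : ℝ) 1) ∧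
        ∀ α ∈ Set.Ico (0 : ℝ) (alphaStar k) \ 𝒞, ∀ ε : ℝ, 0 < ε →
          Tendsto (fun n : ℕ => Pn k n α (φs α - ε)) atTop (𝓝 0) ∧
          Tendsto (fun n : ℕ => Pn k n α (φs α + ε)) atTop (𝓝 1) := by
  refine ⟨{α | α ∈ Set.Ico 0 (alphaStar k) ∧ ¬ ContinuousAt (limitEntropy k) α},
    limitEntropy_antitone.countable_not_continuousAt.mono fun α h => h.2, fun α h => h.1,
    limitEntropy k, fun α _ => limitEntropy_mem k α, fun α hα ε hε => ?_⟩
  have hc : ContinuousAt (limitEntropy k) α := by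
    by_contra h
    exact hα.2 ⟨hα.1, h⟩
  exact ⟨tendsto_Pn_sub hk hα.1.1 hα.1.2 hc hε, tendsto_Pn_add hk hα.1.1 hα.1.2 hc hε⟩
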